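/- arXiv:2409.01858 — 3 statements merged into one kernel-verified Lean document; each statement's English description precedes it below -/
import Mathlib

section
/- Let Ω ⊂ ℝⁿ be a bounded open domain with C¹ boundary, let g ∈ L¹_loc(ℝⁿ) be nonnegative, and let u ∈ C²(Ω) ∩ C¹(Ω̄) satisfy ∂u/∂ν > 0 at every point of ∂Ω, with m := inf_{∂Ω} ∂u/∂ν > 0. Then ∫_{B_m(0)} g(z) dz ≤ ∫_{Γ_u} g(∇u(x)) |det(∇²u(x))| dx. -/
open MeasureTheory Metric
open scoped RealInnerProductSpace

noncomputable section

/-- `ν` is an outward unit normal vector field on the boundary of `Ω`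
(in the first-order sense appropriate for a `C¹` boundary). -/
def IsOutwardUnitNormal {n : ℕ} (Ω : Set (EuclideanSpace ℝ (Fin n)))
    (ν : EuclideanSpace ℝ (Fin n) → EuclideanSpace ℝ (Fin n)) : Prop :=
  ContinuousOn ν (frontier Ω) ∧
  ∀ x ∈ frontier Ω, ‖ν x‖ = 1 ∧
    ∀ ε > 0, ∃ δ > 0, ∀ y ∈ closure Ω, dist y x < δ →
      ⟪ν x, y - x⟫ ≤ ε * ‖y - x‖

/-- The lower contact set `Γ_u` of `u` in `Ω`, where `G` is the gradient field of `u`. -/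
def lowerContactSet {n : ℕ} (Ω : Set (EuclideanSpace ℝ (Fin n)))
    (u : EuclideanSpace ℝ (Fin n) → ℝ)
    (G : EuclideanSpace ℝ (Fin n) → EuclideanSpace ℝ (Fin n)) :
    Set (EuclideanSpace ℝ (Fin n)) :=
  {x ∈ Ω | ∀ y ∈ closure Ω, u x + ⟪G x, y - x⟫ ≤ u y}

/-- The Hessian matrix `∇²u(x)` of `u : ℝⁿ → ℝ` at `x`. -/
def hessianMatrix {n : ℕ} (u : EuclideanSpace ℝ (Fin n) → ℝ)
    (x : EuclideanSpace ℝ (Fin n)) : Matrix (Fin n) (Fin n) ℝ :=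
  Matrix.of fun i j =>
    iteratedFDeriv ℝ 2 u x ![EuclideanSpace.single i 1, EuclideanSpace.single j 1]

abbrev EE (n : ℕ) := EuclideanSpace ℝ (Fin n)

lemma null_det {n : ℕ} (A : Set (EE n)) (hA : MeasurableSet A) (f : EE n → EE n)
    (hc : ∀ x ∈ A, ContDiffAt ℝ 1 f x) (himg : volume (f '' A) = 0) :
    volume {x ∈ A | (fderiv ℝ f x).det ≠ 0} = 0 := by
  refine measure_null_of_locally_null _ ?_
  rintro x ⟨hxA, hdet⟩
  have hd : HasFDerivAt f ((((fderiv ℝ f x).toContinuousLinearEquivOfDetNeZero hdet) : EE n ≃L[ℝ] EE n) : EE n →L[ℝ] EE n) x := by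
    rw [ContinuousLinearMap.coe_toContinuousLinearEquivOfDetNeZero]
    exact ((hc x hxA).differentiableAt (by simp)).hasFDerivAt
  let e := (hc x hxA).toOpenPartialHomeomorph f hd (by simp)
  have hxe : x ∈ e.source := (hc x hxA).mem_toOpenPartialHomeomorph_source hd (by simp)
  have hinj : Set.InjOn f (A ∩ e.source) := by
    intro a ha b hb hab
    exact e.injOn ha.2 hb.2 hab
  have hms : MeasurableSet (A ∩ e.source) := hA.inter e.open_source.measurableSet
  have hder : ∀ y ∈ A ∩ e.source, HasFDerivWithinAt f (fderiv ℝ f y) (A ∩ e.source) y := fun y hy =>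
    ((hc y hy.1).differentiableAt (by simp)).hasFDerivAt.hasFDerivWithinAt
  have h1 := lintegral_abs_det_fderiv_eq_addHaar_image volume hms hder hinj
  have h2 : volume (f '' (A ∩ e.source)) = 0 :=
    measure_mono_null (Set.image_mono Set.inter_subset_left) himg
  rw [h2, lintegral_eq_zero_iff' (aemeasurable_ofReal_abs_det_fderivWithin volume hms hder),
    Filter.EventuallyEq, ae_restrict_iff' hms] at h1
  refine ⟨{y | y ∈ A ∩ e.source ∧ (fderiv ℝ f y).det ≠ 0}, ?_, ?_⟩
  · filter_upwards [self_mem_nhdsWithin, mem_nhdsWithin_of_mem_nhds (e.open_source.mem_nhds hxe)] with y hy1 hy2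
    exact ⟨⟨hy1.1, hy2⟩, hy1.2⟩
  · refine measure_mono_null ?_ h1
    intro y hy hh
    have := hh hy.1
    simp at this
    exact hy.2 this

lemma lip_v {n : ℕ} (K : Set (EE n)) (hK : IsCompact K) (hne : K.Nonempty) (u : EE n → ℝ)
    (hu : ContinuousOn u K) :
    ∃ v : EE n → ℝ, (∃ C, LipschitzWith C v) ∧ (∀ z, ∀ y ∈ K, ⟪z, y⟫ - u y ≤ v z) ∧
      ∀ z c, (∀ y ∈ K, ⟪z, y⟫ - u y ≤ c) → v z ≤ c := by
  have hb : ∀ z, BddAbove ((fun y => ⟪z, y⟫ - u y) '' K) := fun z =>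
    (hK.image_of_continuousOn (by fun_prop)).bddAbove
  have h1 : ∀ z, ∀ y ∈ K, ⟪z, y⟫ - u y ≤ sSup ((fun y => ⟪z, y⟫ - u y) '' K) := fun z y hy =>
    le_csSup (hb z) ⟨y, hy, rfl⟩
  have h2 : ∀ z c, (∀ y ∈ K, ⟪z, y⟫ - u y ≤ c) → sSup ((fun y => ⟪z, y⟫ - u y) '' K) ≤ c := by
    intro z c h
    refine csSup_le (hne.image _) ?_
    rintro _ ⟨y, hy, rfl⟩
    exact h y hy
  refine ⟨fun z => sSup ((fun y => ⟪z, y⟫ - u y) '' K), ?_, h1, h2⟩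
  obtain ⟨R, hR0, hR⟩ := hK.isBounded.exists_pos_norm_le
  refine ⟨R.toNNReal, LipschitzWith.of_le_add_mul _ ?_⟩
  intro z z'
  apply h2
  intro y hy
  have h3 := h1 z' y hy
  have h4 : ⟪z - z', y⟫ ≤ ‖z - z'‖ * ‖y‖ := real_inner_le_norm _ _
  have h5 := hR y hy
  rw [inner_sub_left] at h4
  rw [Real.coe_toNNReal _ hR0.le, dist_eq_norm]
  nlinarith [norm_nonneg (z - z')]

lemma grad_facts {n : ℕ} (Ω : Set (EE n)) (hΩo : IsOpen Ω) (u : EE n → ℝ) (G : EE n → EE n)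
    (hu2 : ContDiffOn ℝ 2 u Ω) (hG : ∀ x ∈ Ω, HasGradientAt u (G x) x) :
    ∀ x ∈ Ω, ContDiffAt ℝ 1 G x ∧ (hessianMatrix u x).det = (fderiv ℝ G x).det := by
  intro x hx
  have hcoord : ∀ i, (fun y => G y i) =ᶠ[nhds x]
      fun y => fderiv ℝ u y (EuclideanSpace.single i 1) := by
    intro i
    filter_upwards [hΩo.mem_nhds hx] with y hy
    rw [(hG y hy).hasFDerivAt.fderiv]
    simp [EuclideanSpace.inner_single_right]
  have hfd : ContDiffAt ℝ 1 (fderiv ℝ u) x :=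
    (hu2.contDiffAt (hΩo.mem_nhds hx)).fderiv_right (by norm_num)
  have hGd : ContDiffAt ℝ 1 G x := by
    rw [contDiffAt_euclidean]
    intro i
    refine ContDiffAt.congr_of_eventuallyEq ?_ (hcoord i)
    exact hfd.clm_apply contDiffAt_const
  refine ⟨hGd, ?_⟩
  have hGdiff : DifferentiableAt ℝ G x := hGd.differentiableAt (by simp)
  have hcomp : ∀ v i, (fderiv ℝ G x v) i = fderiv ℝ (fderiv ℝ u) x v (EuclideanSpace.single i 1) := by
    intro v i
    have e1 : HasFDerivAt (fun y => G y i) ((EuclideanSpace.proj i : EE n →L[ℝ] ℝ).comp (fderiv ℝ G x)) x :=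
      (EuclideanSpace.proj i : EE n →L[ℝ] ℝ).hasFDerivAt.comp x hGdiff.hasFDerivAt
    have e2 : HasFDerivAt (fun y => fderiv ℝ u y (EuclideanSpace.single i (1:ℝ)))
       ((ContinuousLinearMap.apply ℝ ℝ (EuclideanSpace.single i (1:ℝ) : EE n)).comp (fderiv ℝ (fderiv ℝ u) x)) x :=
      (ContinuousLinearMap.apply ℝ ℝ (EuclideanSpace.single i (1:ℝ) : EE n)).hasFDerivAt.comp x
        (hfd.differentiableAt (by simp)).hasFDerivAt
    have e3 := e1.unique (e2.congr_of_eventuallyEq (hcoord i))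
    exact congrArg (fun L : EE n →L[ℝ] ℝ => L v) e3
  have hmat : hessianMatrix u x = (LinearMap.toMatrix (EuclideanSpace.basisFun (Fin n) ℝ).toBasis
      (EuclideanSpace.basisFun (Fin n) ℝ).toBasis (fderiv ℝ G x : EE n →ₗ[ℝ] EE n)).transpose := by
    ext i j
    simp [hessianMatrix, iteratedFDeriv_two_apply, LinearMap.toMatrix_apply, hcomp]
  rw [hmat, Matrix.det_transpose, LinearMap.det_toMatrix]

lemma inj_facts {n : ℕ} (Ω : Set (EE n)) (u : EE n → ℝ) (G : EE n → EE n) (v : EE n → ℝ)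
    (h1 : ∀ z, ∀ y ∈ closure Ω, ⟪z, y⟫ - u y ≤ v z)
    (h2 : ∀ z c, (∀ y ∈ closure Ω, ⟪z, y⟫ - u y ≤ c) → v z ≤ c) (x : EE n)
    (hx : x ∈ lowerContactSet Ω u G) (hd : DifferentiableAt ℝ v (G x)) :
    fderiv ℝ v (G x) = innerSL ℝ x := by
  have hmin : IsLocalMin (fun z => v z - innerSL ℝ x z) (G x) := by
    refine Filter.Eventually.of_forall fun z => ?_
    have a := h1 z x (subset_closure hx.1)
    have b := h2 (G x) (⟪G x, x⟫ - u x) (fun y hy => by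
      have := hx.2 y hy
      rw [inner_sub_right] at this
      linarith)
    simp only [innerSL_apply_apply]
    rw [real_inner_comm z x, real_inner_comm (G x) x] 
    linarith
  have := hmin.hasFDerivAt_eq_zero (hd.hasFDerivAt.sub (innerSL ℝ x).hasFDerivAt)
  exact sub_eq_zero.mp this

lemma meas_contact {n : ℕ} (Ω : Set (EE n)) (hΩo : IsOpen Ω) (u : EE n → ℝ) (G : EE n → EE n)
    (hu : ContinuousOn u (closure Ω)) (hGc : ContinuousOn G (closure Ω)) :
    MeasurableSet (lowerContactSet Ω u G) := by
  have : lowerContactSet Ω u G = Ω ∩ ⋂ y ∈ closure Ω,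
      (closure Ω ∩ (fun x => u x + ⟪G x, y - x⟫) ⁻¹' Set.Iic (u y)) := by
    ext x
    simp only [lowerContactSet, Set.mem_ofPred_eq, Set.mem_inter_iff, Set.mem_iInter, Set.mem_preimage, Set.mem_Iic]
    constructor
    · rintro ⟨a, b⟩
      exact ⟨a, fun y hy => ⟨subset_closure a, b y hy⟩⟩
    · rintro ⟨a, b⟩
      exact ⟨a, fun y hy => (b y hy).2⟩
  rw [this]
  refine hΩo.measurableSet.inter (IsClosed.measurableSet ?_)
  refine isClosed_biInter fun y hy => ?_
  refine ContinuousOn.preimage_isClosed_of_isClosed ?_ isClosed_closure isClosed_Iic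
  exact hu.add (hGc.inner (continuousOn_const.sub continuousOn_id))

lemma stay_inside {n : ℕ} (Ω : Set (EE n)) (hΩo : IsOpen Ω) (ν : EE n → EE n)
    (hν : IsOutwardUnitNormal Ω ν) (x₀ N : EE n) (hN : ‖N‖ = 1) (r : ℝ)
    (hr : ∀ x ∈ frontier Ω, dist x x₀ < r → 0 < ⟪ν x, N⟫)
    (y : EE n) (hy : y ∈ Ω) (hyr : dist y x₀ < r / 2) :
    ∀ s ∈ Set.Icc 0 (r / 2), y - s • N ∈ Ω ∧ dist (y - s • N) x₀ < r := by
  have hdist : ∀ s ∈ Set.Icc 0 (r / 2), dist (y - s • N) x₀ < r := by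
    intro s hs
    have h1 : dist (y - s • N) y = s := by
      rw [dist_eq_norm]
      simp [norm_smul, hN, abs_of_nonneg hs.1]
    have := dist_triangle (y - s • N) y x₀
    linarith [hs.2]
  intro s hs
  refine ⟨?_, hdist s hs⟩
  by_contra hcon
  have hcont : Continuous fun s : ℝ => y - s • N := by fun_prop
  have hScl : IsCompact (Set.Icc 0 (r / 2) ∩ (fun s : ℝ => y - s • N) ⁻¹' Ωᶜ) :=
    isCompact_Icc.inter_right (hΩo.isClosed_compl.preimage hcont)
  obtain ⟨s₀, hs₀, hmin⟩ := hScl.exists_isMinOn ⟨s, hs, hcon⟩ continuousOn_id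
  have hlt : ∀ t, 0 ≤ t → t < s₀ → y - t • N ∈ Ω := by
    intro t ht0 ht
    by_contra hc
    have := hmin (show t ∈ _ from ⟨⟨ht0, ht.le.trans hs₀.1.2⟩, hc⟩)
    simp only [id, Set.mem_ofPred_eq] at this
    linarith
  have hs0pos : 0 < s₀ := by
    rcases hs₀.1.1.lt_or_eq with h | h
    · exact h
    · exfalso
      apply hs₀.2
      rw [← h]
      simpa using hy
  have hcl : y - s₀ • N ∈ closure Ω := by
    have ht : Filter.Tendsto (fun s : ℝ => y - s • N) (nhdsWithin s₀ (Set.Iio s₀)) (nhds (y - s₀ • N)) :=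
      hcont.continuousAt.tendsto.mono_left nhdsWithin_le_nhds
    refine mem_closure_of_tendsto ht ?_
    filter_upwards [Ioo_mem_nhdsLT hs0pos] with t ht
    exact hlt t ht.1.le ht.2
  have hfr : y - s₀ • N ∈ frontier Ω := by
    rw [hΩo.frontier_eq]
    exact ⟨hcl, hs₀.2⟩
  have hb := hr _ hfr (hdist s₀ hs₀.1)
  obtain ⟨δ, hδ, hh⟩ := (hν.2 _ hfr).2 (⟪ν (y - s₀ • N), N⟫ / 2) (by linarith)
  have hτ : 0 < min s₀ (δ / 2) := lt_min hs0pos (by linarith)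
  have hτ1 := min_le_left s₀ (δ / 2)
  have hτ2 := min_le_right s₀ (δ / 2)
  set τ := min s₀ (δ / 2)
  have hdiff : (y - (s₀ - τ) • N) - (y - s₀ • N) = τ • N := by
    rw [sub_smul]; abel
  have hnorm : ‖τ • N‖ = τ := by rw [norm_smul, hN, Real.norm_of_nonneg hτ.le, mul_one]
  have h3 := hh (y - (s₀ - τ) • N) (subset_closure (hlt _ (by linarith) (by linarith))) (by
    rw [dist_eq_norm, hdiff, hnorm]; linarith)
  rw [hdiff, hnorm, inner_smul_right] at h3
  nlinarith

lemma boundary_false {n : ℕ} (Ω : Set (EE n)) (hΩo : IsOpen Ω) (ν : EE n → EE n)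
    (hν : IsOutwardUnitNormal Ω ν) (u : EE n → ℝ) (G : EE n → EE n)
    (hu : ContinuousOn u (closure Ω)) (hG : ∀ x ∈ Ω, HasGradientAt u (G x) x)
    (hGc : ContinuousOn G (closure Ω)) (p x₀ : EE n) (hx₀ : x₀ ∈ frontier Ω)
    (hp : ‖p‖ < ⟪G x₀, ν x₀⟫)
    (hmin : ∀ y ∈ closure Ω, u x₀ - ⟪p, x₀⟫ ≤ u y - ⟪p, y⟫) : False := by
  have hx₀c : x₀ ∈ closure Ω := frontier_subset_closure hx₀
  have hN : ‖ν x₀‖ = 1 := (hν.2 x₀ hx₀).1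
  have ha : 0 < ⟪G x₀ - p, ν x₀⟫ := by
    have := real_inner_le_norm p (ν x₀)
    rw [hN] at this
    rw [inner_sub_left]
    linarith
  have e1 : ∀ᶠ x in nhdsWithin x₀ (frontier Ω), 0 < ⟪ν x, ν x₀⟫ := by
    have hc : ContinuousWithinAt (fun x => ⟪ν x, ν x₀⟫) (frontier Ω) x₀ :=
      (hν.1 x₀ hx₀).inner continuousWithinAt_const
    refine hc.eventually (lt_mem_nhds ?_)
    beta_reduce; rw [real_inner_self_eq_norm_sq, hN]; norm_num
  have e2 : ∀ᶠ x in nhdsWithin x₀ (closure Ω), ⟪G x₀ - p, ν x₀⟫ / 2 < ⟪G x - p, ν x₀⟫ := by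
    have hc : ContinuousWithinAt (fun x => ⟪G x - p, ν x₀⟫) (closure Ω) x₀ :=
      ((hGc x₀ hx₀c).sub continuousWithinAt_const).inner continuousWithinAt_const
    exact hc.eventually (lt_mem_nhds (by linarith))
  set c := ⟪G x₀ - p, ν x₀⟫ / 2 with hcdef
  have hc0 : 0 < c := by linarith
  set N := ν x₀
  obtain ⟨r1, hr1, h1⟩ := Metric.mem_nhdsWithin_iff.mp e1
  obtain ⟨r2, hr2, h2⟩ := Metric.mem_nhdsWithin_iff.mp e2
  set r := min r1 r2
  have hr0 : 0 < r := lt_min hr1 hr2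
  have hs := stay_inside Ω hΩo ν hν x₀ N hN r
    (fun x hx hd => h1 ⟨hd.trans_le (min_le_left _ _), hx⟩)
  have key : ∀ y ∈ Ω, dist y x₀ < r / 2 → u x₀ - ⟪p, x₀⟫ + c * (r / 2) ≤ u y - ⟪p, y⟫ := by
    intro y hy hyr
    have hin := hs y hy hyr
    have hder : ∀ s ∈ Set.Icc 0 (r / 2), HasDerivAt (fun s : ℝ => u (y - s • N) - ⟪p, y - s • N⟫)
        (-⟪G (y - s • N) - p, N⟫) s := by
      intro s hs
      have d1 : HasDerivAt (fun s : ℝ => y - s • N) (-N) s := by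
        simpa using ((hasDerivAt_id s).smul_const N).const_sub y
      have d2 := (hG _ (hin s hs).1).hasFDerivAt.comp_hasDerivAt s d1
      have d3 := (innerSL ℝ p).hasFDerivAt.comp_hasDerivAt s d1
      refine (d2.sub d3).congr_deriv ?_
      simp [inner_sub_left]
      ring
    have hmv := (convex_Icc (0:ℝ) (r / 2)).image_sub_le_mul_sub_of_deriv_le (C := -c)
      (fun s hs => (hder s hs).continuousAt.continuousWithinAt)
      (fun s hs => (hder s (interior_subset hs)).differentiableAt.differentiableWithinAt)
      (fun s hs => by
        rw [(hder s (interior_subset hs)).deriv]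
        have hi := hin s (interior_subset hs)
        have : c < ⟪G (y - s • N) - p, N⟫ := h2 ⟨hi.2.trans_le (min_le_right _ _), subset_closure hi.1⟩
        linarith) 0 ⟨le_rfl, by linarith⟩ (r / 2) ⟨by linarith, le_rfl⟩ (by linarith)
    have hm := hmin _ (subset_closure (hin (r / 2) ⟨by linarith, le_rfl⟩).1)
    simp only [zero_smul, sub_zero] at hmv
    linarith
  have e3 : ∀ᶠ x in nhdsWithin x₀ (closure Ω), u x - ⟪p, x⟫ < u x₀ - ⟪p, x₀⟫ + c * (r / 2) := by
    have hc : ContinuousWithinAt (fun x => u x - ⟪p, x⟫) (closure Ω) x₀ :=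
      (hu x₀ hx₀c).sub (continuousWithinAt_const.inner continuousWithinAt_id)
    refine hc.eventually (gt_mem_nhds ?_)
    have : 0 < c * (r / 2) := by positivity
    linarith
  obtain ⟨r3, hr3, h3⟩ := Metric.mem_nhdsWithin_iff.mp e3
  obtain ⟨y, hy, hyd⟩ := Metric.mem_closure_iff.mp hx₀c (min r3 (r / 2)) (lt_min hr3 (by linarith))
  rw [dist_comm] at hyd
  have a1 := key y hy (hyd.trans_le (min_le_right _ _))
  have a2 : u y - ⟪p, y⟫ < u x₀ - ⟪p, x₀⟫ + c * (r / 2) :=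
    h3 ⟨hyd.trans_le (min_le_left _ _), subset_closure hy⟩
  linarith

lemma ball_subset {n : ℕ} (Ω : Set (EE n)) (hΩo : IsOpen Ω)
    (hΩb : Bornology.IsBounded Ω) (hΩne : Ω.Nonempty) (ν : EE n → EE n)
    (hν : IsOutwardUnitNormal Ω ν) (u : EE n → ℝ) (G : EE n → EE n)
    (hu : ContinuousOn u (closure Ω)) (hG : ∀ x ∈ Ω, HasGradientAt u (G x) x)
    (hGc : ContinuousOn G (closure Ω)) (m : ℝ) (hm : ∀ x ∈ frontier Ω, m ≤ ⟪G x, ν x⟫) :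
    Metric.ball (0 : EE n) m ⊆ G '' lowerContactSet Ω u G := by
  intro p hp
  rw [mem_ball_zero_iff] at hp
  have hφ : ContinuousOn (fun y => u y - ⟪p, y⟫) (closure Ω) :=
    hu.sub (continuousOn_const.inner continuousOn_id)
  obtain ⟨x₀, hx₀, hmin⟩ := hΩb.isCompact_closure.exists_isMinOn hΩne.closure hφ
  have hmin' : ∀ y ∈ closure Ω, u x₀ - ⟪p, x₀⟫ ≤ u y - ⟪p, y⟫ := fun y hy => hmin hy
  have hxΩ : x₀ ∈ Ω := by
    by_contra hc
    have hfr : x₀ ∈ frontier Ω := by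
      rw [hΩo.frontier_eq]; exact ⟨hx₀, hc⟩
    exact boundary_false Ω hΩo ν hν u G hu hG hGc p x₀ hfr (hp.trans_le (hm _ hfr)) hmin'
  have hloc : IsLocalMin (fun y => u y - innerSL ℝ p y) x₀ := by
    filter_upwards [hΩo.mem_nhds hxΩ] with y hy
    exact hmin' y (subset_closure hy)
  have h0 := hloc.hasFDerivAt_eq_zero ((hG x₀ hxΩ).hasFDerivAt.sub (innerSL ℝ p).hasFDerivAt)
  have hGp : G x₀ = p := by
    refine ext_inner_right ℝ fun w => ?_
    have := congrArg (fun L : EE n →L[ℝ] ℝ => L w) h0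
    simpa [sub_eq_zero] using this
  refine ⟨x₀, ⟨hxΩ, fun y hy => ?_⟩, hGp⟩
  have := hmin' y hy
  rw [hGp, inner_sub_right]
  linarith

theorem stmt2 {n : ℕ} (hn : 0 < n)
    (Ω : Set (EuclideanSpace ℝ (Fin n))) (hΩo : IsOpen Ω)
    (hΩb : Bornology.IsBounded Ω) (hΩne : Ω.Nonempty)
    (ν : EuclideanSpace ℝ (Fin n) → EuclideanSpace ℝ (Fin n))
    (hν : IsOutwardUnitNormal Ω ν)
    -- `g ∈ L¹_loc(ℝⁿ)` nonnegative
    (g : EuclideanSpace ℝ (Fin n) → ℝ)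
    (hg_loc : LocallyIntegrable g volume) (hg_nonneg : ∀ z, 0 ≤ g z)
    (u : EuclideanSpace ℝ (Fin n) → ℝ)
    (G : EuclideanSpace ℝ (Fin n) → EuclideanSpace ℝ (Fin n))
    -- `u ∈ C²(Ω) ∩ C¹(Ω̄)`
    (hu2 : ContDiffOn ℝ 2 u Ω)
    (hu : ContinuousOn u (closure Ω))
    (hG : ∀ x ∈ Ω, HasGradientAt u (G x) x)
    (hGc : ContinuousOn G (closure Ω))
    -- `∂u/∂ν > 0` on `∂Ω`
    (hpos : ∀ x ∈ frontier Ω, 0 < ⟪G x, ν x⟫)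
    (m : ℝ) (hm : m = sInf ((fun x => ⟪G x, ν x⟫) '' frontier Ω)) (hm0 : 0 < m) :
    ∫ z in Metric.ball (0 : EuclideanSpace ℝ (Fin n)) m, g z ≤
      ∫ x in lowerContactSet Ω u G, g (G x) * |(hessianMatrix u x).det| := by
  have hK : IsCompact (closure Ω) := hΩb.isCompact_closure
  have hmle : ∀ x ∈ frontier Ω, m ≤ ⟪G x, ν x⟫ := by
    intro x hx
    rw [hm]
    refine csInf_le ⟨0, ?_⟩ ⟨x, hx, rfl⟩
    rintro _ ⟨y, hy, rfl⟩
    exact (hpos y hy).le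
  have hball := ball_subset Ω hΩo hΩb hΩne ν hν u G hu hG hGc m hmle
  have hΓ := meas_contact Ω hΩo u G hu hGc
  have hgrad := grad_facts Ω hΩo u G hu2 hG
  obtain ⟨v, ⟨C, hlip⟩, hv1, hv2⟩ := lip_v (closure Ω) hK hΩne.closure u hu
  have hinjf := inj_facts Ω u G v hv1 hv2
  set Γ := lowerContactSet Ω u G with hΓdef
  have hΓΩ : Γ ⊆ Ω := fun x hx => hx.1
  have hDm : MeasurableSet {z | DifferentiableAt ℝ v z} := measurableSet_of_differentiableAt ℝ v
  have hD0 : volume {z | DifferentiableAt ℝ v z}ᶜ = 0 := hlip.ae_differentiableAt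
  set D := {z | DifferentiableAt ℝ v z} with hD
  have hA : MeasurableSet (Γ ∩ G ⁻¹' D) := by
    have hGm : Measurable (fun x : Γ => G x) :=
      (continuousOn_iff_continuous_restrict.mp
        (hGc.mono (hΓΩ.trans subset_closure))).measurable
    have := (MeasurableEmbedding.subtype_coe hΓ).measurableSet_image.mpr (hGm hDm)
    convert this using 1
    ext x
    simp [and_comm]
  have hder : ∀ x ∈ Γ ∩ G ⁻¹' D, HasFDerivWithinAt G (fderiv ℝ G x) (Γ ∩ G ⁻¹' D) x := fun x hx =>
    ((hgrad x (hΓΩ hx.1)).1.differentiableAt (by simp)).hasFDerivAt.hasFDerivWithinAt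
  have hinj : Set.InjOn G (Γ ∩ G ⁻¹' D) := by
    intro x hx y hy hxy
    have a := hinjf x hx.1 hx.2
    have b := hinjf y hy.1 hy.2
    rw [hxy, b] at a
    refine ext_inner_right ℝ fun w => ?_
    have := congrArg (fun L : EE n →L[ℝ] ℝ => L w) a
    simpa using this.symm
  have hnull : volume {x ∈ Γ \ (Γ ∩ G ⁻¹' D) | (fderiv ℝ G x).det ≠ 0} = 0 := by
    refine null_det _ (hΓ.diff hA) G (fun x hx => (hgrad x (hΓΩ hx.1)).1) ?_
    refine measure_mono_null ?_ hD0
    rintro _ ⟨x, hx, rfl⟩ hxD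
    exact hx.2 ⟨hx.1, hxD⟩
  have hRHS : ∫ x in Γ, g (G x) * |(hessianMatrix u x).det| =
      ∫ x in Γ ∩ G ⁻¹' D, |(fderiv ℝ G x).det| • g (G x) := by
    have hcongr : ∫ x in Γ, g (G x) * |(hessianMatrix u x).det| =
        ∫ x in Γ, |(fderiv ℝ G x).det| • g (G x) := by
      refine setIntegral_congr_fun hΓ fun x hx => ?_
      simp only [(hgrad x (hΓΩ hx)).2, smul_eq_mul, mul_comm]
    rw [hcongr]
    refine (setIntegral_eq_of_subset_of_ae_diff_eq_zero hΓ.nullMeasurableSet Set.inter_subset_left ?_).trans rfl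
    refine (measure_eq_zero_iff_ae_notMem.mp hnull).mono ?_
    intro x hx hxd
    have : (fderiv ℝ G x).det = 0 := by
      by_contra h
      exact hx ⟨hxd, h⟩
    simp [this]
  rw [hRHS, ← integral_image_eq_integral_abs_det_fderiv_smul volume hA hder hinj g]
  have hint : IntegrableOn g (G '' (Γ ∩ G ⁻¹' D)) := by
    refine (hg_loc.integrableOn_isCompact (hK.image_of_continuousOn hGc)).mono_set ?_
    exact Set.image_mono fun x hx => subset_closure (hΓΩ hx.1)
  refine setIntegral_mono_set hint (Filter.Eventually.of_forall fun z => hg_nonneg z) ?_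
  have hDae : ∀ᵐ z ∂(volume : Measure (EuclideanSpace ℝ (Fin n))), z ∈ D := hlip.ae_differentiableAt
  filter_upwards [hDae] with z hz hzb
  obtain ⟨x, hx, rfl⟩ := hball hzb
  exact ⟨x, ⟨hx, hz⟩, rfl⟩
end
end

section
/- For every dimension n ≥ 1 and every K ≥ 0 there exists a constant C = C(n, K) > 0 with the following property. Let R > 0, let f ∈ C¹(ℝ), and let u be a smooth solution of Δu = f(u) in the ball B_R ⊂ ℝⁿ with u = 0 on ∂B_R, extended by zero outside B_R, such that R² ‖f'(u)‖_{L^∞(B_R)} ≤ K. Then sup_{B_R} |∇u|² ≤ C ( (1/(n² |B₁|^{2/n})) ‖f(u)‖²_{L^n(B_R)} + R ‖ |∇²u|² ‖_{L^n(B_R)} ), where |∇²u|² = Σ_{i,j} u_{x_i x_j}². -/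
open MeasureTheory Metric
open scoped RealInnerProductSpace

noncomputable section

/-- The second partial derivative `∂²u/∂xᵢ∂xⱼ` at `x`. -/
def secondPartial {n : ℕ} (u : EuclideanSpace ℝ (Fin n) → ℝ)
    (x : EuclideanSpace ℝ (Fin n)) (i j : Fin n) : ℝ :=
  iteratedFDeriv ℝ 2 u x ![EuclideanSpace.single i 1, EuclideanSpace.single j 1]

/-- The Laplacian `Δu(x) = Σᵢ ∂²u/∂xᵢ²` of `u : ℝⁿ → ℝ` at `x`. -/
def lap {n : ℕ} (u : EuclideanSpace ℝ (Fin n) → ℝ)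
    (x : EuclideanSpace ℝ (Fin n)) : ℝ :=
  ∑ i, secondPartial u x i i

open Set in
/-- Linear change of variables for a homothety centred at `x`. -/
lemma aux_scale {n : ℕ} (g : EuclideanSpace ℝ (Fin n) → ENNReal) (hg : Measurable g)
    (x : EuclideanSpace ℝ (Fin n)) (t : ℝ) (ht : 0 < t) :
    ∫⁻ y, g (x + t • (y - x)) = ENNReal.ofReal ((t ^ n)⁻¹) * ∫⁻ y, g y := by
  have h1 : ∀ y, g (x + t • (y - x)) = (fun z => g ((x - t • x) + z)) (t • y) := by
    intro y
    simp only [smul_sub]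
    congr 1
    abel
  simp_rw [h1]
  have hm : Measurable (fun z => g ((x - t • x) + z)) := by fun_prop
  rw [← lintegral_map hm (measurable_const_smul t)]
  rw [Measure.map_addHaar_smul volume ht.ne', lintegral_smul_measure]
  rw [lintegral_add_left_eq_self]
  simp [abs_of_pos ht]

lemma aux_holder {n : ℕ} (hn : 1 ≤ n) (g : EuclideanSpace ℝ (Fin n) → ENNReal) (hg : Measurable g)
    (x : EuclideanSpace ℝ (Fin n)) (t : ℝ) (ht : 0 < t) (s : Set (EuclideanSpace ℝ (Fin n))) :
    ∫⁻ y in s, g (x + t • (y - x)) ≤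
      ENNReal.ofReal (t ^ (-(1 / 2) : ℝ)) * ((∫⁻ y, g y ^ (2 * n : ℝ)) ^ (1 / (2 * n : ℝ)) *
        volume s ^ (1 - 1 / (2 * n : ℝ))) := by
  have hn' : (1 : ℝ) ≤ n := by exact_mod_cast hn
  have hp : (1 : ℝ) < 2 * n := by linarith
  have hpq := Real.HolderConjugate.conjExponent hp
  have hm : Measurable (fun y => g (x + t • (y - x))) := by fun_prop
  have := ENNReal.lintegral_mul_le_Lp_mul_Lq (volume.restrict s) hpq hm.aemeasurable
    (aemeasurable_const (b := 1))
  simp only [Pi.mul_apply, mul_one, ENNReal.one_rpow, lintegral_one, Measure.restrict_apply_univ]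
    at this
  refine this.trans ?_
  have hq : 1 / (Real.conjExponent (2 * n)) = 1 - 1 / (2 * n : ℝ) := by
    have := hpq.inv_add_inv_eq_one
    simp only [one_div]; linarith
  rw [hq, ← mul_assoc]
  gcongr
  calc (∫⁻ y in s, g (x + t • (y - x)) ^ (2 * n : ℝ)) ^ (1 / (2 * n : ℝ))
      ≤ (∫⁻ y, g (x + t • (y - x)) ^ (2 * n : ℝ)) ^ (1 / (2 * n : ℝ)) := by
        gcongr
        exact Measure.restrict_le_self
    _ = _ := by
        rw [aux_scale (fun z => g z ^ (2 * n : ℝ)) (by fun_prop) x t ht,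
          ENNReal.mul_rpow_of_nonneg _ _ (by positivity),
          ENNReal.ofReal_rpow_of_nonneg (by positivity) (by positivity)]
        congr 2
        rw [← Real.rpow_natCast, ← Real.rpow_neg ht.le, ← Real.rpow_mul ht.le]
        congr 1
        field_simp

lemma aux_half : ∫⁻ t in Set.Icc (0 : ℝ) 1, ENNReal.ofReal (t ^ (-(1 / 2) : ℝ)) = 2 := by
  rw [← restrict_Ioc_eq_restrict_Icc, ← ofReal_integral_eq_lintegral_ofReal]
  · rw [← intervalIntegral.integral_of_le zero_le_one, integral_rpow (by norm_num)]
    norm_num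
  · rw [← IntegrableOn, ← intervalIntegrable_iff_integrableOn_Ioc_of_le zero_le_one]
    exact intervalIntegral.intervalIntegrable_rpow' (by norm_num)
  · filter_upwards [self_mem_ae_restrict measurableSet_Ioc] with t ht
    exact Real.rpow_nonneg ht.1.le _

lemma aux_double {n : ℕ} (hn : 1 ≤ n) (g : EuclideanSpace ℝ (Fin n) → ENNReal) (hg : Measurable g)
    (x : EuclideanSpace ℝ (Fin n)) (s : Set (EuclideanSpace ℝ (Fin n))) :
    ∫⁻ y in s, ∫⁻ t in Set.Icc (0 : ℝ) 1, g (x + t • (y - x)) ≤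
      2 * ((∫⁻ y, g y ^ (2 * n : ℝ)) ^ (1 / (2 * n : ℝ)) *
        volume s ^ (1 - 1 / (2 * n : ℝ))) := by
  have hA := fun t ht => aux_holder hn g hg x t ht s
  rw [lintegral_lintegral_swap]
  · generalize (∫⁻ y, g y ^ (2 * n : ℝ)) ^ (1 / (2 * n : ℝ)) *
        volume s ^ (1 - 1 / (2 * n : ℝ)) = A at hA
    rw [show 2 * A = (∫⁻ t in Set.Icc (0 : ℝ) 1, ENNReal.ofReal (t ^ (-(1 / 2) : ℝ))) * A by
      rw [aux_half], ← lintegral_mul_const _ (by fun_prop), ← restrict_Ioc_eq_restrict_Icc]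
    refine setLIntegral_mono' measurableSet_Ioc fun t ht => ?_
    exact hA t ht.1
  · apply Measurable.aemeasurable
    apply hg.comp
    fun_prop

/-- Morrey's inequality on a ball, with exponent `2n`. -/
lemma aux_morrey {n : ℕ} (hn : 1 ≤ n) {F : Type*} [NormedAddCommGroup F] [NormedSpace ℝ F]
    (R : ℝ) (hR : 0 < R) (v : EuclideanSpace ℝ (Fin n) → F)
    (hv : ContDiffOn ℝ 1 v (ball 0 R)) (g : EuclideanSpace ℝ (Fin n) → ENNReal) (hg : Measurable g)
    (hgv : ∀ z ∈ ball (0 : EuclideanSpace ℝ (Fin n)) R, ‖fderiv ℝ v z‖ₑ ≤ g z)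
    (x x₀ : EuclideanSpace ℝ (Fin n)) (hx : x ∈ ball 0 R) (hx₀ : x₀ ∈ ball 0 R) :
    ‖v x - v x₀‖ₑ * volume (ball (0 : EuclideanSpace ℝ (Fin n)) R) ≤
      ENNReal.ofReal (8 * R) * ((∫⁻ y, g y ^ (2 * n : ℝ)) ^ (1 / (2 * n : ℝ)) *
        volume (ball (0 : EuclideanSpace ℝ (Fin n)) R) ^ (1 - 1 / (2 * n : ℝ))) := by
  have key : ∀ a ∈ ball (0 : EuclideanSpace ℝ (Fin n)) R,
      ∀ y ∈ ball (0 : EuclideanSpace ℝ (Fin n)) R,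
      ‖v y - v a‖ₑ ≤ ENNReal.ofReal (2 * R) * ∫⁻ t in Set.Icc (0 : ℝ) 1, g (a + t • (y - a)) := by
    intro a ha y hy
    have hseg : ∀ t ∈ Set.Icc (0 : ℝ) 1, a + t • (y - a) ∈ ball (0 : EuclideanSpace ℝ (Fin n)) R :=
      fun t ht => (convex_ball _ _).add_smul_sub_mem ha hy ht
    have hc : ContDiffOn ℝ 1 (fun t : ℝ => v (a + t • (y - a))) (Set.Icc 0 1) := by
      apply hv.comp (t := ball 0 R) (f := fun t : ℝ => a + t • (y - a)) _ hseg
      fun_prop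
    have h := enorm_sub_le_lintegral_deriv_of_contDiffOn_Icc hc zero_le_one
    simp only [one_smul, zero_smul, add_zero, add_sub_cancel] at h
    refine h.trans ?_
    rw [← lintegral_const_mul _ (by fun_prop)]
    refine setLIntegral_mono' measurableSet_Icc fun t ht => ?_
    have hd : HasFDerivAt v (fderiv ℝ v (a + t • (y - a))) (a + t • (y - a)) :=
      ((hv.differentiableOn (by norm_num)).differentiableAt
        (isOpen_ball.mem_nhds (hseg t ht))).hasFDerivAt
    have hl : HasDerivAt (fun t : ℝ => a + t • (y - a)) (y - a) t := by
      simpa using ((hasDerivAt_id t).smul_const (y - a)).const_add a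
    have hd2 := hd.comp_hasDerivAt t hl
    have e : deriv (fun t : ℝ => v (a + t • (y - a))) t
        = fderiv ℝ v (a + t • (y - a)) (y - a) := hd2.deriv
    rw [e]
    refine (ContinuousLinearMap.le_opENorm _ _).trans ?_
    rw [mul_comm]
    gcongr
    · rw [← ofReal_norm]
      apply ENNReal.ofReal_le_ofReal
      have := norm_sub_le y a
      simp at ha hy
      linarith
    · exact hgv _ (hseg t ht)
  have half : ∀ a ∈ ball (0 : EuclideanSpace ℝ (Fin n)) R,
      ∫⁻ y in ball 0 R, ‖v y - v a‖ₑ ≤ ENNReal.ofReal (2 * R) *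
      (2 * ((∫⁻ y, g y ^ (2 * n : ℝ)) ^ (1 / (2 * n : ℝ)) *
        volume (ball (0 : EuclideanSpace ℝ (Fin n)) R) ^ (1 - 1 / (2 * n : ℝ)))) := by
    intro a ha
    refine (setLIntegral_mono' measurableSet_ball fun y hy => key a ha y hy).trans ?_
    rw [lintegral_const_mul' _ _ ENNReal.ofReal_ne_top]
    gcongr
    exact aux_double hn g hg a _
  have hvm : AEMeasurable (fun y => ‖v y - v x‖ₑ) (volume.restrict (ball 0 R)) := by
    have hco : ContinuousOn (fun y => ‖v y - v x‖ₑ) (ball 0 R) :=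
      continuous_enorm.comp_continuousOn (hv.continuousOn.sub continuousOn_const)
    exact hco.aemeasurable measurableSet_ball
  rw [← setLIntegral_const]
  calc ∫⁻ y in ball (0 : EuclideanSpace ℝ (Fin n)) R, ‖v x - v x₀‖ₑ
      ≤ ∫⁻ y in ball 0 R, (‖v y - v x‖ₑ + ‖v y - v x₀‖ₑ) := by
        apply lintegral_mono
        intro y
        have : v x - v x₀ = -(v y - v x) + (v y - v x₀) := by abel
        rw [this]
        refine (enorm_add_le _ _).trans ?_
        rw [enorm_neg]
    _ = (∫⁻ y in ball 0 R, ‖v y - v x‖ₑ) + ∫⁻ y in ball 0 R, ‖v y - v x₀‖ₑ :=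
        lintegral_add_left' hvm _
    _ ≤ _ := add_le_add (half x hx) (half x₀ hx₀)
    _ = _ := by
        have : ENNReal.ofReal (8 * R) = ENNReal.ofReal (2 * R) * 2 * 2 := by
          rw [show (8 * R) = 2 * R * 2 * 2 by ring, ENNReal.ofReal_mul (by positivity),
            ENNReal.ofReal_mul (by positivity)]
          norm_num
        rw [this]
        ring

/-- A continuous function vanishing off the ball has an interior critical point. -/
lemma aux_crit {n : ℕ} (R : ℝ) (hR : 0 < R) (u : EuclideanSpace ℝ (Fin n) → ℝ)
    (hu : ContinuousOn u (closedBall 0 R))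
    (h0 : ∀ x ∉ ball (0 : EuclideanSpace ℝ (Fin n)) R, u x = 0) :
    ∃ x ∈ ball (0 : EuclideanSpace ℝ (Fin n)) R, fderiv ℝ u x = 0 := by
  have hne : (closedBall (0 : EuclideanSpace ℝ (Fin n)) R).Nonempty := ⟨0, by simp [hR.le]⟩
  obtain ⟨a, ha, hmax⟩ := (isCompact_closedBall _ _).exists_isMaxOn hne hu
  obtain ⟨b, hb, hmin⟩ := (isCompact_closedBall _ _).exists_isMinOn hne hu
  by_cases ha' : a ∈ ball (0 : EuclideanSpace ℝ (Fin n)) R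
  · exact ⟨a, ha', (hmax.isLocalMax (Filter.mem_of_superset (isOpen_ball.mem_nhds ha')
      ball_subset_closedBall)).fderiv_eq_zero⟩
  by_cases hb' : b ∈ ball (0 : EuclideanSpace ℝ (Fin n)) R
  · exact ⟨b, hb', (hmin.isLocalMin (Filter.mem_of_superset (isOpen_ball.mem_nhds hb')
      ball_subset_closedBall)).fderiv_eq_zero⟩
  refine ⟨0, by simp [hR], ?_⟩
  have hz : IsLocalMax u 0 := by
    filter_upwards [closedBall_mem_nhds (0 : EuclideanSpace ℝ (Fin n)) hR] with y hy
    have h1 := hmax hy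
    have h2 := hmin (show (0 : EuclideanSpace ℝ (Fin n)) ∈ closedBall 0 R by simp [hR.le])
    simp only [Set.mem_ofPred_eq, h0 a ha', h0 b hb'] at h1 h2
    linarith
  exact hz.fderiv_eq_zero

/-- The operator norm is bounded by the Hilbert-Schmidt norm. -/
lemma aux_hs {n : ℕ} (u : EuclideanSpace ℝ (Fin n) → ℝ) (z : EuclideanSpace ℝ (Fin n)) :
    ‖fderiv ℝ (fderiv ℝ u) z‖ ≤ √(∑ i, ∑ j, secondPartial u z i j ^ 2) := by
  refine ContinuousLinearMap.opNorm_le_bound₂ _ (Real.sqrt_nonneg _) fun a b => ?_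
  have hs : ∀ i j, secondPartial u z i j = fderiv ℝ (fderiv ℝ u) z (EuclideanSpace.single i 1)
      (EuclideanSpace.single j 1) := by
    intro i j
    simp [secondPartial, iteratedFDeriv_two_apply]
  have hdec : ∀ c : EuclideanSpace ℝ (Fin n), c = ∑ i, c i • EuclideanSpace.single i (1 : ℝ) := by
    intro c
    ext k
    simp [Finset.sum_apply, Pi.single_apply]
  have hab : fderiv ℝ (fderiv ℝ u) z a b = ∑ p : Fin n × Fin n, (a p.1 * b p.2) *
      secondPartial u z p.1 p.2 := by
    conv_lhs => rw [hdec a, hdec b]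
    simp only [map_sum, map_smul, _root_.sum_apply, _root_.smul_apply,
      smul_eq_mul, ← hs, Fintype.sum_prod_type, Finset.mul_sum]
    rw [Finset.sum_comm]
    refine Finset.sum_congr rfl fun i _ => Finset.sum_congr rfl fun j _ => by ring
  have hcs := Finset.sum_mul_sq_le_sq_mul_sq Finset.univ
    (fun p : Fin n × Fin n => a p.1 * b p.2) (fun p => secondPartial u z p.1 p.2)
  rw [← hab] at hcs
  have hn2 : ∑ p : Fin n × Fin n, (a p.1 * b p.2) ^ 2 = ‖a‖ ^ 2 * ‖b‖ ^ 2 := by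
    rw [EuclideanSpace.real_norm_sq_eq, EuclideanSpace.real_norm_sq_eq, Finset.sum_mul_sum,
      Fintype.sum_prod_type]
    simp [mul_pow]
  rw [hn2, Fintype.sum_prod_type] at hcs
  rw [Real.norm_eq_abs]
  apply abs_le_of_sq_le_sq _ (by positivity)
  rw [mul_pow, mul_pow, Real.sq_sqrt (by positivity)]
  linarith

lemma aux_bdd {n : ℕ} (R : ℝ) (hR : 0 < R) (u : EuclideanSpace ℝ (Fin n) → ℝ)
    (hu : ContDiffOn ℝ (⊤ : ℕ∞) u (closedBall 0 R)) :
    ContinuousOn (fun y => ∑ i, ∑ j, secondPartial u y i j ^ 2) (ball 0 R) ∧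
    ∃ M : ℝ, ∀ y ∈ ball (0 : EuclideanSpace ℝ (Fin n)) R,
      ∑ i, ∑ j, secondPartial u y i j ^ 2 ≤ M := by
  have hud : UniqueDiffOn ℝ (closedBall (0 : EuclideanSpace ℝ (Fin n)) R) := by
    apply uniqueDiffOn_convex (convex_closedBall _ _)
    exact ⟨0, mem_interior_iff_mem_nhds.2 (closedBall_mem_nhds _ hR)⟩
  have hcont := hu.continuousOn_iteratedFDerivWithin (m := 2)
    (WithTop.coe_le_coe.2 (le_top : ((2 : ℕ) : ℕ∞) ≤ ⊤)) hud
  let w : EuclideanSpace ℝ (Fin n) → ℝ := fun y => ∑ i, ∑ j,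
    (iteratedFDerivWithin ℝ 2 u (closedBall 0 R) y
      ![EuclideanSpace.single i 1, EuclideanSpace.single j 1]) ^ 2
  have hw : ContinuousOn w (closedBall 0 R) := by
    refine continuousOn_finsetSum _ fun i _ => continuousOn_finsetSum _ fun j _ => ?_
    apply ContinuousOn.pow
    exact (ContinuousMultilinearMap.apply ℝ (fun _ : Fin 2 => EuclideanSpace ℝ (Fin n)) ℝ
      ![EuclideanSpace.single i 1, EuclideanSpace.single j 1]).continuous.comp_continuousOn hcont
  have heq : ∀ y ∈ ball (0 : EuclideanSpace ℝ (Fin n)) R,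
      ∑ i, ∑ j, secondPartial u y i j ^ 2 = w y := by
    intro y hy
    have : iteratedFDerivWithin ℝ 2 u (closedBall 0 R) y = iteratedFDeriv ℝ 2 u y := by
      rw [← iteratedFDerivWithin_univ]
      apply iteratedFDerivWithin_congr_set
      exact Filter.eventuallyEq_univ.2 (Filter.mem_of_superset (isOpen_ball.mem_nhds hy)
        ball_subset_closedBall)
    simp only [w, this, secondPartial]
  refine ⟨(hw.mono ball_subset_closedBall).congr heq, ?_⟩
  obtain ⟨M, hM⟩ := (isCompact_closedBall _ _).bddAbove_image hw
  exact ⟨M, fun y hy => by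
    rw [heq y hy]; exact hM (Set.mem_image_of_mem _ (ball_subset_closedBall hy))⟩

theorem stmt9 :
    ∀ (n : ℕ), 1 ≤ n → ∀ K : ℝ, 0 ≤ K →
    ∃ C : ℝ, 0 < C ∧
      ∀ R : ℝ, 0 < R →
      ∀ f : ℝ → ℝ, ContDiff ℝ 1 f →
      ∀ u : EuclideanSpace ℝ (Fin n) → ℝ,
        -- `u` is a smooth solution of `Δu = f(u)` in `B_R`, vanishing outside `B_R`
        ContDiffOn ℝ (⊤ : ℕ∞) u (closure (Metric.ball (0 : EuclideanSpace ℝ (Fin n)) R)) →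
        (∀ x ∈ Metric.ball (0 : EuclideanSpace ℝ (Fin n)) R, lap u x = f (u x)) →
        (∀ x ∉ Metric.ball (0 : EuclideanSpace ℝ (Fin n)) R, u x = 0) →
        -- `R² ‖f'(u)‖_{L^∞(B_R)} ≤ K`
        (∀ x ∈ Metric.ball (0 : EuclideanSpace ℝ (Fin n)) R,
          R ^ 2 * |deriv f (u x)| ≤ K) →
        ∀ x ∈ Metric.ball (0 : EuclideanSpace ℝ (Fin n)) R,
          ‖gradient u x‖ ^ 2 ≤
            C * ((1 / ((n : ℝ) ^ 2 *
                (volume (Metric.ball (0 : EuclideanSpace ℝ (Fin n)) 1)).toReal ^ ((2 : ℝ) / n))) *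
                ((∫ y in Metric.ball (0 : EuclideanSpace ℝ (Fin n)) R,
                  |f (u y)| ^ (n : ℝ)) ^ ((n : ℝ)⁻¹)) ^ 2 +
              R * (∫ y in Metric.ball (0 : EuclideanSpace ℝ (Fin n)) R,
                  (∑ i, ∑ j, secondPartial u y i j ^ 2) ^ (n : ℝ)) ^ ((n : ℝ)⁻¹)) := by
  intro n hn K hK
  have hn' : (1 : ℝ) ≤ n := by exact_mod_cast hn
  set b := (volume (Metric.ball (0 : EuclideanSpace ℝ (Fin n)) 1)).toReal with hb
  have hbpos : 0 < b := ENNReal.toReal_pos (measure_ball_pos _ _ one_pos).ne'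
    measure_ball_lt_top.ne
  refine ⟨64 * (b ^ ((n : ℝ)⁻¹))⁻¹, by positivity, ?_⟩
  intro R hR f _ u hu _ h0 _ x hx
  rw [closure_ball _ hR.ne'] at hu
  set h : EuclideanSpace ℝ (Fin n) → ℝ := fun y => ∑ i, ∑ j, secondPartial u y i j ^ 2 with hh
  have hnn : ∀ y, 0 ≤ h y := fun y => by simp only [hh]; positivity
  obtain ⟨hcont, M, hM⟩ := aux_bdd R hR u hu
  change ContinuousOn h _ at hcont
  change ∀ y ∈ ball (0 : EuclideanSpace ℝ (Fin n)) R, h y ≤ M at hM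
  obtain ⟨x₀, hx₀, hcrit⟩ := aux_crit R hR u hu.continuousOn h0
  have hv : ContDiffOn ℝ 1 (fderiv ℝ u) (ball 0 R) :=
    (hu.mono ball_subset_closedBall).fderiv_of_isOpen isOpen_ball
      (WithTop.coe_le_coe.2 (le_top : ((2 : ℕ) : ℕ∞) ≤ ⊤))
  set I : ℝ := ∫ y in ball 0 R, h y ^ (n : ℝ) with hI
  have hI0 : 0 ≤ I := integral_nonneg fun y => Real.rpow_nonneg (hnn y) _
  have hint : IntegrableOn (fun y => h y ^ (n : ℝ)) (ball 0 R) := by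
    have : IsFiniteMeasure (volume.restrict (ball (0 : EuclideanSpace ℝ (Fin n)) R)) :=
      isFiniteMeasure_restrict.2 measure_ball_lt_top.ne
    refine Integrable.of_bound ?_ (M ^ (n : ℝ)) ?_
    · exact (hcont.rpow_const fun y _ => Or.inr (Nat.cast_nonneg n)).aestronglyMeasurable
        measurableSet_ball
    · filter_upwards [self_mem_ae_restrict measurableSet_ball] with y hy
      rw [Real.norm_of_nonneg (Real.rpow_nonneg (hnn y) _)]
      exact Real.rpow_le_rpow (hnn y) (hM y hy) (by positivity)
  classical
  set g : EuclideanSpace ℝ (Fin n) → ENNReal :=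
    (ball 0 R).piecewise (fun y => ENNReal.ofReal √(h y)) (fun _ => 0) with hg
  have hgm : Measurable g := by
    refine ContinuousOn.measurable_piecewise ?_ continuousOn_const measurableSet_ball
    exact ENNReal.continuous_ofReal.comp_continuousOn hcont.sqrt
  have hgI : ∫⁻ y, g y ^ (2 * n : ℝ) = ENNReal.ofReal I := by
    rw [hI, ofReal_integral_eq_lintegral_ofReal hint
      (Filter.Eventually.of_forall fun y => Real.rpow_nonneg (hnn y) _),
      ← lintegral_indicator measurableSet_ball]
    congr 1
    ext y
    by_cases hy : y ∈ ball (0 : EuclideanSpace ℝ (Fin n)) R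
    · rw [hg, Set.piecewise_eq_of_mem _ _ _ hy, Set.indicator_of_mem hy,
        ENNReal.ofReal_rpow_of_nonneg (Real.sqrt_nonneg _) (by positivity),
        Real.rpow_mul (Real.sqrt_nonneg _), Real.rpow_two, Real.sq_sqrt (hnn y)]
    · rw [hg, Set.piecewise_eq_of_notMem _ _ _ hy, Set.indicator_of_notMem hy,
        ENNReal.zero_rpow_of_pos (by positivity)]
  have hmor := aux_morrey hn R hR (fderiv ℝ u) hv g hgm (by
    intro z hz
    rw [hg, Set.piecewise_eq_of_mem _ _ _ hz, ← ofReal_norm]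
    exact ENNReal.ofReal_le_ofReal (aux_hs u z)) x x₀ hx hx₀
  rw [hcrit, sub_zero, hgI] at hmor
  have hVt : volume (ball (0 : EuclideanSpace ℝ (Fin n)) R) = ENNReal.ofReal (R ^ n * b) := by
    rw [Measure.addHaar_ball_of_pos _ _ hR, ENNReal.ofReal_mul (by positivity), hb,
      ENNReal.ofReal_toReal measure_ball_lt_top.ne]
    simp
  set V := R ^ n * b with hV
  have hVpos : 0 < V := by positivity
  rw [hVt, ENNReal.ofReal_rpow_of_nonneg hI0 (by positivity),
    ENNReal.ofReal_rpow_of_pos hVpos, ← ofReal_norm,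
    ← ENNReal.ofReal_mul (by positivity), ← ENNReal.ofReal_mul (by positivity),
    ← ENNReal.ofReal_mul (by positivity), ENNReal.ofReal_le_ofReal_iff (by positivity),
    Real.rpow_sub hVpos, Real.rpow_one] at hmor
  have hgrad : ‖gradient u x‖ = ‖fderiv ℝ u x‖ := by
    rw [gradient, LinearIsometryEquiv.norm_map]
  rw [hgrad]
  set G := ‖fderiv ℝ u x‖ with hG
  set q : ℝ := 1 / (2 * n) with hq
  have hVq : 0 < V ^ q := Real.rpow_pos_of_pos hVpos _
  have h1 : G * V ^ q ≤ 8 * R * I ^ q := by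
    have e : 8 * R * (I ^ q * (V / V ^ q)) = (8 * R * I ^ q) / V ^ q * V := by
      field_simp
    rw [e] at hmor
    have := le_of_mul_le_mul_right hmor hVpos
    rwa [le_div_iff₀ hVq] at this
  have hsq : ∀ a : ℝ, 0 ≤ a → (a ^ q) ^ 2 = a ^ ((n : ℝ)⁻¹) := by
    intro a ha
    rw [← Real.rpow_natCast, ← Real.rpow_mul ha, hq]
    congr 1
    push_cast
    field_simp
  have h2 : G ^ 2 * V ^ ((n : ℝ)⁻¹) ≤ 64 * R ^ 2 * I ^ ((n : ℝ)⁻¹) := by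
    have := pow_le_pow_left₀ (by positivity) h1 2
    rw [mul_pow, mul_pow, hsq V hVpos.le, hsq I hI0] at this
    linarith
  have hV3 : V ^ ((n : ℝ)⁻¹) = R * b ^ ((n : ℝ)⁻¹) := by
    rw [hV, Real.mul_rpow (by positivity) hbpos.le, Real.pow_rpow_inv_natCast hR.le (by omega)]
  rw [hV3] at h2
  set B := b ^ ((n : ℝ)⁻¹) with hB
  have hBpos : 0 < B := Real.rpow_pos_of_pos hbpos _
  have h3 : G ^ 2 ≤ 64 * B⁻¹ * (R * I ^ ((n : ℝ)⁻¹)) := by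
    have e : 64 * B⁻¹ * (R * I ^ ((n : ℝ)⁻¹)) = (64 * R ^ 2 * I ^ ((n : ℝ)⁻¹)) / (R * B) := by
      field_simp
    rw [e, le_div_iff₀ (by positivity)]
    exact h2
  refine h3.trans ?_
  gcongr
  apply le_add_of_nonneg_left
  positivity
end
end

section
/- Let Ω ⊂ ℝⁿ be a bounded open domain with C¹ boundary, let the coefficients a_{ij}(x, s, p) satisfy the ellipticity condition θ̃|ξ|² ≤ Σ_{i,j} a_{ij}(x, s, p) ξ_i ξ_j ≤ Θ̃|ξ|² for all (x, s, p) and all ξ ∈ ℝⁿ, with constants 0 < θ̃ ≤ Θ̃, and let u ∈ C²(Ω) ∩ C¹(Ω̄), u not identically zero, solve the quasi-linear eigenvalue problem −Σ_{i,j} a_{ij}(x, u, ∇u) u_{x_i x_j} = λu in Ω with u = 0 on ∂Ω, for some λ ∈ ℝ. Then λ ≥ n θ̃ |B₁|^{1/n} · inf_{∂Ω} |∇u| / ‖u‖_{L^n(Ω)}. -/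
open MeasureTheory Metric
open scoped RealInnerProductSpace

noncomputable section

namespace Aux18

open Set Filter Topology

/-- AM-GM in power form. -/
theorem amgm_pow {n : ℕ} (hn : 0 < n) (μ : Fin n → ℝ) (hμ : ∀ i, 0 ≤ μ i) :
    (∏ i, μ i) ≤ ((∑ i, μ i) / n) ^ n := by
  have h := Real.geom_mean_le_arith_mean_weighted Finset.univ (fun _ : Fin n => (n : ℝ)⁻¹) μ
    (fun i _ => by positivity) (by simp; field_simp) (fun i _ => hμ i)
  have h0 : 0 ≤ ∏ i, μ i ^ ((n : ℝ)⁻¹) := Finset.prod_nonneg (fun i _ => Real.rpow_nonneg (hμ i) _)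
  have h2 := pow_le_pow_left₀ h0 h n
  rw [← Finset.prod_pow] at h2
  have e1 : ∀ i, (μ i ^ ((n : ℝ)⁻¹)) ^ n = μ i := fun i => Real.rpow_inv_natCast_pow (hμ i) hn.ne'
  simp only [e1] at h2
  refine h2.trans (le_of_eq ?_)
  rw [← Finset.mul_sum, div_eq_inv_mul]

/-- The linear-algebra step. -/
theorem linalg_bound {n : ℕ} (hn : 0 < n) (T : EuclideanSpace ℝ (Fin n) →L[ℝ] EuclideanSpace ℝ (Fin n))
    (hT : ∀ v w, ⟪T v, w⟫ = ⟪v, T w⟫) (hpos : ∀ v, 0 ≤ ⟪T v, v⟫)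
    (A : Matrix (Fin n) (Fin n) ℝ) (θ : ℝ) (hθ : 0 < θ)
    (hA : ∀ ξ : EuclideanSpace ℝ (Fin n), θ * ‖ξ‖ ^ 2 ≤ ∑ i, ∑ j, A i j * ξ i * ξ j) :
    0 ≤ ∑ i, ∑ j, A i j * ⟪T (EuclideanSpace.single i 1), EuclideanSpace.single j 1⟫ ∧
    |T.det| ≤ ((∑ i, ∑ j, A i j * ⟪T (EuclideanSpace.single i 1), EuclideanSpace.single j 1⟫)
      / (n * θ)) ^ n := by
  have hS : (T : EuclideanSpace ℝ (Fin n) →ₗ[ℝ] EuclideanSpace ℝ (Fin n)).IsSymmetric :=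
    fun v w => hT v w
  have hd : Module.finrank ℝ (EuclideanSpace ℝ (Fin n)) = n := by simp
  set b := hS.eigenvectorBasis hd with hb
  set μ := hS.eigenvalues hd with hμdef
  have hap : ∀ k, T (b k) = μ k • b k := fun k => by
    exact hS.apply_eigenvectorBasis hd k
  have hμ : ∀ k, 0 ≤ μ k := fun k => by
    have := hpos (b k)
    rw [hap, inner_smul_left, real_inner_self_eq_norm_sq, b.norm_eq_one] at this
    simpa using this
  have hdet : T.det = ∏ k, μ k := by
    have := hS.det_eq_prod_eigenvalues hd
    simpa using this
  have hij : ∀ i j, ⟪T (EuclideanSpace.single i 1), (EuclideanSpace.single j 1 : EuclideanSpace ℝ (Fin n))⟫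
      = ∑ k, μ k * (b k i * b k j) := by
    intro i j
    rw [← b.sum_inner_mul_inner]
    refine Finset.sum_congr rfl fun k _ => ?_
    rw [hT, hap, inner_smul_right]
    simp [EuclideanSpace.inner_single_left, EuclideanSpace.inner_single_right]
    ring
  have hsum : ∑ i, ∑ j, A i j * ⟪T (EuclideanSpace.single i 1), (EuclideanSpace.single j 1 : EuclideanSpace ℝ (Fin n))⟫
      = ∑ k, μ k * ∑ i, ∑ j, A i j * b k i * b k j := by
    simp only [hij, Finset.mul_sum]
    rw [Finset.sum_congr rfl (fun i _ => Finset.sum_comm), Finset.sum_comm]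
    refine Finset.sum_congr rfl fun k _ => Finset.sum_congr rfl fun i _ =>
      Finset.sum_congr rfl fun j _ => ?_
    ring
  have hge : θ * ∑ k, μ k ≤ ∑ i, ∑ j, A i j * ⟪T (EuclideanSpace.single i 1), (EuclideanSpace.single j 1 : EuclideanSpace ℝ (Fin n))⟫ := by
    rw [hsum, Finset.mul_sum]
    refine Finset.sum_le_sum fun k _ => ?_
    have := hA (b k)
    rw [b.norm_eq_one] at this
    have := mul_le_mul_of_nonneg_left this (hμ k)
    linarith
  have hs0 : 0 ≤ ∑ k, μ k := Finset.sum_nonneg fun k _ => hμ k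
  refine ⟨le_trans (by positivity) hge, ?_⟩
  rw [hdet, abs_of_nonneg (Finset.prod_nonneg fun k _ => hμ k)]
  refine (amgm_pow hn μ hμ).trans ?_
  have hn' : (0 : ℝ) < n := by exact_mod_cast hn
  refine pow_le_pow_left₀ (by positivity) ?_ n
  rw [div_le_div_iff₀ hn' (by positivity)]
  nlinarith

/-- Second order necessary condition in one variable. -/
theorem second_order_one (f f' : ℝ → ℝ) (c : ℝ) (hf : ∀ᶠ t in 𝓝 0, HasDerivAt f (f' t) t)
    (hf' : HasDerivAt f' c 0) (hmin : IsLocalMin f 0) : f' 0 = 0 ∧ 0 ≤ c := by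
  have h0 : f' 0 = 0 := hmin.hasDerivAt_eq_zero hf.self_of_nhds
  refine ⟨h0, ?_⟩
  by_contra hc
  push Not at hc
  have hdf : deriv f =ᶠ[𝓝 0] f' := hf.mono fun t ht => ht.deriv
  have hdd : deriv (deriv f) 0 = c := by rw [hdf.deriv_eq, hf'.deriv]
  have hmax : IsLocalMax f 0 := isLocalMax_of_deriv_deriv_neg (by rw [hdd]; exact hc)
    (by rw [hf.self_of_nhds.deriv, h0]) hf.self_of_nhds.continuousAt
  have hconst : f =ᶠ[𝓝 0] fun _ => f 0 := by
    filter_upwards [hmax, hmin] with t h1 h2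
    exact le_antisymm h1 h2
  have h1 : deriv f =ᶠ[𝓝 0] deriv (fun _ => f 0) := hconst.deriv
  have h2 := h1.deriv_eq
  rw [hdd] at h2
  simp at h2
  linarith

section

variable {E : Type*} [NormedAddCommGroup E] [InnerProductSpace ℝ E] [CompleteSpace E]

theorem line_deriv_aux (w : E → ℝ) (g : E) (z v : E) (t : ℝ)
    (h : HasGradientAt w g (z + t • v)) :
    HasDerivAt (fun s : ℝ => w (z + s • v)) ⟪g, v⟫ t := by
  have h1 : HasDerivAt (fun s : ℝ => z + s • v) v t := by
    simpa using ((hasDerivAt_id t).smul_const v).const_add z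
  have := (hasGradientAt_iff_hasFDerivAt.1 h).comp_hasDerivAt t h1
  rw [InnerProductSpace.toDual_apply_apply] at this
  exact this

/-- Contact points. -/
theorem contact (Ω : Set E) (hΩ : IsOpen Ω) (w : E → ℝ) (G : E → E)
    (hG : ∀ x ∈ Ω, HasGradientAt w (G x) x) (hD : ∀ x ∈ Ω, DifferentiableAt ℝ G x)
    (p z : E) (hz : z ∈ Ω) (hmin : ∀ x ∈ Ω, w z - ⟪p, z⟫ ≤ w x - ⟪p, x⟫) :
    G z = p ∧ ∀ v, 0 ≤ ⟪fderiv ℝ G z v, v⟫ := by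
  have key : ∀ v, ⟪G z, v⟫ - ⟪p, v⟫ = 0 ∧ 0 ≤ ⟪fderiv ℝ G z v, v⟫ := by
    intro v
    have hline : ∀ t : ℝ, HasDerivAt (fun s : ℝ => z + s • v) v t := fun t => by
      simpa using ((hasDerivAt_id t).smul_const v).const_add z
    have hev : ∀ᶠ t : ℝ in 𝓝 0, z + t • v ∈ Ω := by
      apply (hline 0).continuousAt.eventually_mem
      simpa using hΩ.mem_nhds hz
    have := second_order_one (fun t => w (z + t • v) - ⟪p, z + t • v⟫)
      (fun t => ⟪G (z + t • v), v⟫ - ⟪p, v⟫) ⟪fderiv ℝ G z v, v⟫ ?_ ?_ ?_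
    · simpa using this
    · filter_upwards [hev] with t ht
      refine (line_deriv_aux w _ z v t (hG _ ht)).sub ?_
      have := (hasDerivAt_const t p).inner ℝ (hline t)
      simpa using this
    · have h1 : HasDerivAt (fun t : ℝ => G (z + t • v)) (fderiv ℝ G z v) 0 := by
        have h2 : HasFDerivAt G (fderiv ℝ G z) (z + (0 : ℝ) • v) := by
          simpa using (hD z hz).hasFDerivAt
        exact h2.comp_hasDerivAt 0 (hline 0)
      have := (h1.inner ℝ (hasDerivAt_const 0 v)).sub_const ⟪p, v⟫
      simpa using this
    · filter_upwards [hev] with t ht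
      simpa using hmin _ ht
  refine ⟨?_, fun v => (key v).2⟩
  apply ext_inner_right ℝ
  intro v
  linarith [(key v).1]

/-- Following a direction along which `w` increases, starting with `w y ≥ 0`, stays inside. -/
theorem stay_inside (Ω : Set E) (hΩ : IsOpen Ω) (w : E → ℝ) (G : E → E)
    (hw : ContinuousOn w (closure Ω))
    (hG : ∀ x ∈ Ω, HasGradientAt w (G x) x) (hbd : ∀ x ∈ frontier Ω, w x = 0)
    (y e : E) (hy : y ∈ Ω) (hwy : 0 ≤ w y) (r k : ℝ) (hr : 0 < r) (hk : 0 < k)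
    (hk' : ∀ t ∈ Icc 0 r, y + t • e ∈ Ω → k ≤ ⟪G (y + t • e), e⟫) :
    y + r • e ∈ Ω ∧ k * r ≤ w (y + r • e) := by
  have hcont : Continuous (fun t : ℝ => y + t • e) := by fun_prop
  have mv : ∀ t1, 0 < t1 → t1 ≤ r → (∀ t ∈ Ico 0 t1, y + t • e ∈ Ω) →
      y + t1 • e ∈ closure Ω ∧ k * t1 ≤ w (y + t1 • e) := by
    intro t1 h0 h1 hin
    have hcl : y + t1 • e ∈ closure Ω := by
      refine mem_closure_of_tendsto (f := fun t : ℝ => y + t • e) (b := 𝓝[<] t1)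
        (hcont.continuousWithinAt) ?_
      filter_upwards [Ico_mem_nhdsLT h0] with t ht using hin t ht
    refine ⟨hcl, ?_⟩
    have hc : ContinuousOn (fun t : ℝ => w (y + t • e)) (Icc 0 t1) := by
      refine hw.comp hcont.continuousOn ?_
      intro t ht
      rcases eq_or_lt_of_le ht.2 with h | h
      · rw [h]; exact hcl
      · exact subset_closure (hin t ⟨ht.1, h⟩)
    obtain ⟨c, hc1, hc2⟩ := exists_hasDerivAt_eq_slope _ (fun t => ⟪G (y + t • e), e⟫) h0 hc
      (fun t ht => line_deriv_aux w _ y e t (hG _ (hin t ⟨ht.1.le, ht.2⟩)))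
    have h3 := hk' c ⟨hc1.1.le, hc1.2.le.trans h1⟩ (hin c ⟨hc1.1.le, hc1.2⟩)
    rw [hc2, le_div_iff₀ (by linarith)] at h3
    simp at h3
    linarith
  have hall : ∀ t ∈ Icc 0 r, y + t • e ∈ Ω := by
    by_contra hcon
    push Not at hcon
    obtain ⟨t0, ht0, hnot⟩ := hcon
    have hK : IsCompact (Icc 0 r ∩ (fun t : ℝ => y + t • e) ⁻¹' Ωᶜ) :=
      isCompact_Icc.inter_right (hΩ.isClosed_compl.preimage hcont)
    obtain ⟨t1, ht1, hmin⟩ := hK.exists_isLeast ⟨t0, ht0, hnot⟩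
    have hpos : 0 < t1 := by
      rcases eq_or_lt_of_le ht1.1.1 with h | h
      · exfalso; apply ht1.2; rw [← h]; simpa using hy
      · exact h
    have := mv t1 hpos ht1.1.2 (fun t ht => by
      by_contra hc
      have := hmin (show t ∈ _ from ⟨⟨ht.1, ht.2.le.trans ht1.1.2⟩, hc⟩)
      linarith [ht.2])
    have hfr : y + t1 • e ∈ frontier Ω := by
      rw [hΩ.frontier_eq]; exact ⟨this.1, ht1.2⟩
    have h4 := hbd _ hfr
    have : 0 < k * t1 := by positivity
    linarith
  exact ⟨hall r ⟨hr.le, le_rfl⟩, (mv r hr le_rfl (fun t ht => hall t ⟨ht.1, ht.2.le⟩)).2⟩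

/-- `|w|` cannot be bounded by `q |x - x₀|` at a boundary point with `q < |G x₀|`. -/
theorem boundary_contra (Ω : Set E) (hΩ : IsOpen Ω) (w : E → ℝ) (G : E → E)
    (hw : ContinuousOn w (closure Ω)) (hGc : ContinuousOn G (closure Ω))
    (hG : ∀ x ∈ Ω, HasGradientAt w (G x) x) (hbd : ∀ x ∈ frontier Ω, w x = 0)
    (x₀ : E) (hx₀ : x₀ ∈ frontier Ω) (q : ℝ) (hq : 0 ≤ q) (hqG : q < ‖G x₀‖)
    (hle : ∀ x ∈ Ω, |w x| ≤ q * ‖x - x₀‖) : False := by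
  have hcl : x₀ ∈ closure Ω := frontier_subset_closure hx₀
  set k := (q + ‖G x₀‖) / 2 with hk
  have hqk : q < k := by rw [hk]; linarith
  have hkG : k < ‖G x₀‖ := by rw [hk]; linarith
  have hGpos : 0 < ‖G x₀‖ := by linarith
  set e := (‖G x₀‖)⁻¹ • G x₀ with he
  have hen : ‖e‖ = 1 := by rw [he, norm_smul]; simp; field_simp
  have hGe : ⟪G x₀, e⟫ = ‖G x₀‖ := by
    rw [he, inner_smul_right, real_inner_self_eq_norm_sq]; field_simp
  have hev : ∀ᶠ z in 𝓝[closure Ω] x₀, k < ⟪G z, e⟫ := by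
    have : ContinuousWithinAt (fun z => ⟪G z, e⟫) (closure Ω) x₀ :=
      (hGc x₀ hcl).inner continuousWithinAt_const
    exact this.eventually (lt_mem_nhds (by show k < ⟪G x₀, e⟫; rw [hGe]; exact hkG))
  obtain ⟨ρ, hρ, hball⟩ := Metric.mem_nhdsWithin_iff.1 hev
  set r := ρ / 2 with hr
  have hrpos : 0 < r := by positivity
  set δ := min r ((k - q) * r / (q + 1)) with hδ
  have hδpos : 0 < δ := by
    apply lt_min hrpos
    apply div_pos (mul_pos (by linarith) hrpos) (by linarith)
  obtain ⟨y, hy, hyd⟩ := Metric.mem_closure_iff.1 hcl δ hδpos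
  rw [dist_comm, dist_eq_norm] at hyd
  have hδr : δ ≤ r := min_le_left _ _
  have hδq : q * δ < (k - q) * r := by
    have h1 : δ ≤ (k - q) * r / (q + 1) := min_le_right _ _
    rw [le_div_iff₀ (by linarith)] at h1
    nlinarith
  have hnear : ∀ s : ℝ, |s| ≤ r → y + s • e ∈ Ω → k < ⟪G (y + s • e), e⟫ := by
    intro s hs hin
    refine hball ⟨?_, subset_closure hin⟩
    rw [mem_ball, dist_eq_norm]
    have : y + s • e - x₀ = (y - x₀) + s • e := by abel
    rw [this]
    refine (norm_add_le _ _).trans_lt ?_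
    rw [norm_smul, hen, Real.norm_eq_abs]
    linarith
  have hfin : ∀ s : ℝ, |s| = r → y + s • e ∈ Ω → k * r ≤ |w (y + s • e)| → False := by
    intro s hs hin hge
    have h1 := hle _ hin
    have : y + s • e - x₀ = (y - x₀) + s • e := by abel
    have h2 : ‖y + s • e - x₀‖ ≤ δ + r := by
      rw [this]
      refine (norm_add_le _ _).trans ?_
      rw [norm_smul, hen, Real.norm_eq_abs]
      linarith
    have h3 := mul_le_mul_of_nonneg_left h2 hq
    nlinarith
  rcases le_total 0 (w y) with h0 | h0
  · obtain ⟨h1, h2⟩ := stay_inside Ω hΩ w G hw hG hbd y e hy h0 r k hrpos (by linarith)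
      (fun t ht hin => (hnear t (by rw [abs_of_nonneg ht.1]; exact ht.2) hin).le)
    exact hfin r (abs_of_pos hrpos) h1 (h2.trans (le_abs_self _))
  · obtain ⟨h1, h2⟩ := stay_inside Ω hΩ (fun x => - w x) (fun x => - G x) hw.neg
      (fun x hx => by
        have := (hasGradientAt_iff_hasFDerivAt.1 (hG x hx)).neg
        rw [hasGradientAt_iff_hasFDerivAt, map_neg]; exact this)
      (fun x hx => by simp [hbd x hx]) y (-e) hy (by simpa using h0) r k hrpos (by linarith)
      (fun t ht hin => by
        have := hnear (-t) (by rw [abs_neg, abs_of_nonneg ht.1]; exact ht.2) (by simpa using hin)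
        simpa using this.le)
    refine hfin (-r) (by rw [abs_neg, abs_of_pos hrpos]) (by simpa using h1) ?_
    have h3 : k * r ≤ - w (y + (-r) • e) := by simpa using h2
    exact h3.trans (neg_le_abs _)

/-- Existence of interior contact points. -/
theorem exists_contact (Ω : Set E) (hΩ : IsOpen Ω) (hc : IsCompact (closure Ω))
    (w : E → ℝ) (hw : ContinuousOn w (closure Ω)) (hbd : ∀ x ∈ frontier Ω, w x = 0)
    (p x₀ : E) (hx₀ : ∀ x ∈ frontier Ω, ⟪p, x⟫ ≤ ⟪p, x₀⟫)
    (hex : ∃ x ∈ Ω, w x - ⟪p, x⟫ < - ⟪p, x₀⟫) :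
    ∃ z ∈ Ω, w z - ⟪p, z⟫ < - ⟪p, x₀⟫ ∧ ∀ x ∈ Ω, w z - ⟪p, z⟫ ≤ w x - ⟪p, x⟫ := by
  obtain ⟨x, hx, hlt⟩ := hex
  have hcont : ContinuousOn (fun z => w z - ⟪p, z⟫) (closure Ω) :=
    hw.sub (Continuous.continuousOn (by fun_prop))
  obtain ⟨z, hz, hmin⟩ := hc.exists_isMinOn ⟨x, subset_closure hx⟩ hcont
  have h1 : ∀ x ∈ Ω, w z - ⟪p, z⟫ ≤ w x - ⟪p, x⟫ := fun x hx => hmin (subset_closure hx)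
  have h2 := (h1 x hx).trans_lt hlt
  refine ⟨z, ?_, h2, h1⟩
  by_contra hnot
  have hfr : z ∈ frontier Ω := by rw [hΩ.frontier_eq]; exact ⟨hz, hnot⟩
  have := hx₀ z hfr
  rw [hbd z hfr] at h2
  linarith

end

/-- The area-formula step. -/
theorem half_bound {n : ℕ} (hn : 0 < n) (Ω : Set (EuclideanSpace ℝ (Fin n))) (hΩ : IsOpen Ω)
    (w : EuclideanSpace ℝ (Fin n) → ℝ) (hw : ContinuousOn w Ω)
    (G : EuclideanSpace ℝ (Fin n) → EuclideanSpace ℝ (Fin n))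
    (hD : ∀ x ∈ Ω, DifferentiableAt ℝ G x)
    (hsym : ∀ x ∈ Ω, ∀ v w, ⟪fderiv ℝ G x v, w⟫ = ⟪v, fderiv ℝ G x w⟫)
    (b : EuclideanSpace ℝ (Fin n) → Matrix (Fin n) (Fin n) ℝ) (θ : ℝ) (hθ : 0 < θ)
    (hb : ∀ x, ∀ ξ : EuclideanSpace ℝ (Fin n), θ * ‖ξ‖ ^ 2 ≤ ∑ i, ∑ j, b x i j * ξ i * ξ j)
    (lam : ℝ)
    (heq : ∀ x ∈ Ω, ∑ i, ∑ j, b x i j * ⟪fderiv ℝ G x (EuclideanSpace.single i 1),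
      EuclideanSpace.single j 1⟫ = - (lam * w x)) :
    volume (G '' {z | z ∈ Ω ∧ ∀ v, 0 ≤ ⟪fderiv ℝ G z v, v⟫}) ≤
      ∫⁻ x in Ω, ENNReal.ofReal ((max (-(lam * w x)) 0 / (n * θ)) ^ n) := by
  classical
  have hmw : Measurable (Ω.indicator w) := by
    have := hw.measurable_piecewise (g := (0 : EuclideanSpace ℝ (Fin n) → ℝ)) continuousOn_const hΩ.measurableSet
    rwa [Set.piecewise_eq_indicator] at this
  have hmd : Measurable (fun x => |(fderiv ℝ G x).det|) :=
    (ContinuousLinearMap.continuous_det.measurable.comp (measurable_fderiv ℝ G)).abs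
  set S := Ω ∩ {x | |(fderiv ℝ G x).det| ≤
    (max (-(lam * Ω.indicator w x)) 0 / (n * θ)) ^ n} with hS
  have hSm : MeasurableSet S := by
    refine hΩ.measurableSet.inter (measurableSet_le hmd ?_)
    exact (((hmw.const_mul lam).neg.max measurable_const).div_const _).pow_const n
  have hsub : {z | z ∈ Ω ∧ ∀ v, 0 ≤ ⟪fderiv ℝ G z v, v⟫} ⊆ S := by
    rintro z ⟨hz, hpos⟩
    refine ⟨hz, ?_⟩
    have h := linalg_bound hn (fderiv ℝ G z) (hsym z hz) hpos (b z) θ hθ (hb z)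
    rw [heq z hz] at h
    simp only [mem_setOf_eq, indicator_of_mem hz]
    rw [max_eq_left h.1]
    exact h.2
  calc volume (G '' {z | z ∈ Ω ∧ ∀ v, 0 ≤ ⟪fderiv ℝ G z v, v⟫})
      ≤ volume (G '' S) := measure_mono (image_mono hsub)
    _ ≤ ∫⁻ x in S, ENNReal.ofReal |(fderiv ℝ G x).det| :=
        addHaar_image_le_lintegral_abs_det_fderiv volume hSm
          (fun x hx => (hD x hx.1).hasFDerivAt.hasFDerivWithinAt)
    _ ≤ ∫⁻ x in S, ENNReal.ofReal ((max (-(lam * w x)) 0 / (n * θ)) ^ n) := by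
        refine setLIntegral_mono' hSm fun x hx => ENNReal.ofReal_le_ofReal ?_
        have := hx.2
        simpa only [mem_setOf_eq, indicator_of_mem hx.1] using this
    _ ≤ _ := lintegral_mono_set inter_subset_left

theorem frontier_nonempty_aux {n : ℕ} (hn : 0 < n) (Ω : Set (EuclideanSpace ℝ (Fin n)))
    (hΩo : IsOpen Ω) (hΩb : Bornology.IsBounded Ω) (hΩne : Ω.Nonempty) : (frontier Ω).Nonempty := by
  haveI : Nonempty (Fin n) := ⟨⟨0, hn⟩⟩
  rw [nonempty_frontier_iff]
  refine ⟨hΩne, fun h => ?_⟩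
  rw [h] at hΩb
  exact NormedSpace.unbounded_univ ℝ (EuclideanSpace ℝ (Fin n)) hΩb

theorem hessian_facts {n : ℕ} (Ω : Set (EuclideanSpace ℝ (Fin n))) (hΩo : IsOpen Ω)
    (u : EuclideanSpace ℝ (Fin n) → ℝ)
    (G : EuclideanSpace ℝ (Fin n) → EuclideanSpace ℝ (Fin n))
    (hu2 : ContDiffOn ℝ 2 u Ω) (hG : ∀ x ∈ Ω, HasGradientAt u (G x) x)
    (x : EuclideanSpace ℝ (Fin n)) (hx : x ∈ Ω) :
    DifferentiableAt ℝ G x ∧ (∀ v w, ⟪fderiv ℝ G x v, w⟫ = ⟪v, fderiv ℝ G x w⟫) ∧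
    ∀ i j, secondPartial u x i j =
      ⟪fderiv ℝ G x (EuclideanSpace.single i 1), EuclideanSpace.single j 1⟫ := by
  have hc : ContDiffAt ℝ 2 u x := hu2.contDiffAt (hΩo.mem_nhds hx)
  have hd1 : DifferentiableAt ℝ (fderiv ℝ u) x :=
    (hc.fderiv_right (m := 1) (by norm_num)).differentiableAt (by norm_num)
  have hev : G =ᶠ[𝓝 x] fun y => (InnerProductSpace.toDual ℝ _).symm (fderiv ℝ u y) := by
    filter_upwards [hΩo.mem_nhds hx] with y hy
    rw [(hasGradientAt_iff_hasFDerivAt.1 (hG y hy)).fderiv, LinearIsometryEquiv.symm_apply_apply]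
  have hev2 : fderiv ℝ u =ᶠ[𝓝 x] fun y => innerSL ℝ (G y) := by
    filter_upwards [hΩo.mem_nhds hx] with y hy
    rw [(hasGradientAt_iff_hasFDerivAt.1 (hG y hy)).fderiv]
    ext v
    simp
  have hGd : DifferentiableAt ℝ G x := by
    refine DifferentiableAt.congr_of_eventuallyEq ?_ hev
    exact ((InnerProductSpace.toDual ℝ
      (EuclideanSpace ℝ (Fin n))).symm.differentiableAt).comp x hd1
  have key : ∀ v w, fderiv ℝ (fderiv ℝ u) x v w = ⟪fderiv ℝ G x v, w⟫ := by
    intro v w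
    have h1 : HasFDerivAt (fun y => innerSL ℝ (G y)) ((innerSL ℝ).comp (fderiv ℝ G x)) x :=
      (innerSL ℝ).hasFDerivAt.comp x hGd.hasFDerivAt
    rw [hev2.fderiv_eq, h1.fderiv]
    simp
  refine ⟨hGd, ?_, ?_⟩
  · intro v w
    have := hc.isSymmSndFDerivAt (by simp) v w
    rw [key, key] at this
    rw [this, real_inner_comm]
  · intro i j
    rw [secondPartial, iteratedFDeriv_two_apply]
    simp [key]

theorem final_arith (n : ℕ) (hn : 0 < n) (θ m ω lam I : ℝ) (hθ : 0 < θ) (hm : 0 ≤ m) (hω : 0 ≤ ω)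
    (hlam : 0 ≤ lam) (hI : 0 ≤ I) (h : m ^ n * ω ≤ (lam / (n * θ)) ^ n * I) :
    lam ≥ n * θ * ω ^ ((n : ℝ)⁻¹) * m / I ^ ((n : ℝ)⁻¹) := by
  have hn' : (0 : ℝ) < n := by exact_mod_cast hn
  have h1 : m * ω ^ ((n : ℝ)⁻¹) ≤ lam / (n * θ) * I ^ ((n : ℝ)⁻¹) := by
    rw [← pow_le_pow_iff_left₀ (by positivity) (by positivity) hn.ne', mul_pow, mul_pow,
      Real.rpow_inv_natCast_pow hω hn.ne', Real.rpow_inv_natCast_pow hI hn.ne']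
    exact h
  rcases (Real.rpow_nonneg hI ((n : ℝ)⁻¹)).eq_or_lt with h0 | h0
  · rw [← h0]; simpa using hlam
  · rw [ge_iff_le, div_le_iff₀ h0]
    rw [div_mul_eq_mul_div, le_div_iff₀ (by positivity)] at h1
    linarith

end Aux18

open Aux18 Set Filter Topology in
theorem stmt18 {n : ℕ} (hn : 0 < n)
    (Ω : Set (EuclideanSpace ℝ (Fin n))) (hΩo : IsOpen Ω)
    (hΩb : Bornology.IsBounded Ω) (hΩne : Ω.Nonempty)
    (ν : EuclideanSpace ℝ (Fin n) → EuclideanSpace ℝ (Fin n))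
    (hν : IsOutwardUnitNormal Ω ν)
    -- coefficients `a_{ij}(x, s, p)` with ellipticity constants `0 < θ̃ ≤ Θ̃`
    (a : EuclideanSpace ℝ (Fin n) → ℝ → EuclideanSpace ℝ (Fin n) → Matrix (Fin n) (Fin n) ℝ)
    (θ Θ : ℝ) (hθ : 0 < θ) (hθΘ : θ ≤ Θ)
    (hell : ∀ x s p, ∀ ξ : EuclideanSpace ℝ (Fin n),
      θ * ‖ξ‖ ^ 2 ≤ ∑ i, ∑ j, a x s p i j * ξ i * ξ j ∧
      ∑ i, ∑ j, a x s p i j * ξ i * ξ j ≤ Θ * ‖ξ‖ ^ 2)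
    (u : EuclideanSpace ℝ (Fin n) → ℝ)
    (G : EuclideanSpace ℝ (Fin n) → EuclideanSpace ℝ (Fin n))
    -- `u ∈ C²(Ω) ∩ C¹(Ω̄)`
    (hu2 : ContDiffOn ℝ 2 u Ω)
    (hu : ContinuousOn u (closure Ω))
    (hG : ∀ x ∈ Ω, HasGradientAt u (G x) x)
    (hGc : ContinuousOn G (closure Ω))
    -- `u` not identically zero
    (hune : ∃ x ∈ Ω, u x ≠ 0)
    -- `-Σ a_{ij}(x, u, ∇u) u_{x_i x_j} = λ u` in `Ω`
    (lam : ℝ)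
    (heq : ∀ x ∈ Ω,
      -(∑ i, ∑ j, a x (u x) (G x) i j * secondPartial u x i j) = lam * u x)
    -- `u = 0` on `∂Ω`
    (hbd : ∀ x ∈ frontier Ω, u x = 0) :
    lam ≥ n * θ * (volume (Metric.ball (0 : EuclideanSpace ℝ (Fin n)) 1)).toReal ^ ((n : ℝ)⁻¹) *
      sInf ((fun x => ‖G x‖) '' frontier Ω) / (∫ x in Ω, |u x| ^ (n : ℝ)) ^ ((n : ℝ)⁻¹) := by
  classical
  have hn' : (0 : ℝ) < n := by exact_mod_cast hn
  have hcpt : IsCompact (closure Ω) := hΩb.isCompact_closure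
  have hfne := frontier_nonempty_aux hn Ω hΩo hΩb hΩne
  have hfc : IsCompact (frontier Ω) := hcpt.of_isClosed_subset isClosed_frontier
    frontier_subset_closure
  have hH := hessian_facts Ω hΩo u G hu2 hG
  have hGn : ∀ x ∈ Ω, HasGradientAt (fun x => - u x) (- G x) x := fun x hx => by
    have := (hasGradientAt_iff_hasFDerivAt.1 (hG x hx)).neg
    rw [hasGradientAt_iff_hasFDerivAt, map_neg]; exact this
  have hun : ContinuousOn (fun x => - u x) (closure Ω) := hu.neg
  have hbdn : ∀ x ∈ frontier Ω, - u x = 0 := fun x hx => by simp [hbd x hx]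
  have hDn : ∀ x ∈ Ω, DifferentiableAt ℝ (fun x => - G x) x := fun x hx => (hH x hx).1.neg
  have hfdn : ∀ x, fderiv ℝ (fun x => - G x) x = - fderiv ℝ G x := fun x => fderiv_fun_neg
  set b : EuclideanSpace ℝ (Fin n) → Matrix (Fin n) (Fin n) ℝ := fun x => a x (u x) (G x) with hbdef
  have hb : ∀ x, ∀ ξ : EuclideanSpace ℝ (Fin n),
      θ * ‖ξ‖ ^ 2 ≤ ∑ i, ∑ j, b x i j * ξ i * ξ j := fun x ξ => (hell x _ _ ξ).1
  have heq1 : ∀ x ∈ Ω, ∑ i, ∑ j, b x i j * ⟪fderiv ℝ G x (EuclideanSpace.single i 1),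
      (EuclideanSpace.single j 1 : EuclideanSpace ℝ (Fin n))⟫ = - (lam * u x) := by
    intro x hx
    rw [← heq x hx, neg_neg]
    simp only [(hH x hx).2.2, hbdef]
  have heq2 : ∀ x ∈ Ω, ∑ i, ∑ j, b x i j *
      ⟪fderiv ℝ (fun x => - G x) x (EuclideanSpace.single i 1),
      (EuclideanSpace.single j 1 : EuclideanSpace ℝ (Fin n))⟫ = - (lam * - u x) := by
    intro x hx
    have := heq1 x hx
    simp only [hfdn, ContinuousLinearMap.neg_apply, inner_neg_left, mul_neg,
      Finset.sum_neg_distrib, this]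
  have hsym2 : ∀ x ∈ Ω, ∀ v w, ⟪fderiv ℝ (fun x => - G x) x v, w⟫
      = ⟪v, fderiv ℝ (fun x => - G x) x w⟫ := by
    intro x hx v w
    simp only [hfdn, ContinuousLinearMap.neg_apply, inner_neg_left, inner_neg_right,
      (hH x hx).2.1 v w]
  -- nonnegativity of `lam`
  have hlam : 0 ≤ lam := by
    obtain ⟨x, hx, hne⟩ := hune
    obtain ⟨x₀, hx₀⟩ := hfne
    rcases lt_or_gt_of_ne hne with h | h
    · obtain ⟨z, hz, hlt, hmin⟩ := exists_contact Ω hΩo hcpt u hu hbd 0 x₀ (by simp)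
        ⟨x, hx, by simpa using h⟩
      have hps := (contact Ω hΩo u G hG (fun x hx => (hH x hx).1) 0 z hz hmin).2
      have := (linalg_bound hn _ (hH z hz).2.1 hps (b z) θ hθ (hb z)).1
      rw [heq1 z hz] at this
      have hz0 : u z < 0 := by simpa using hlt
      by_contra hc
      push Not at hc
      nlinarith [mul_pos_of_neg_of_neg hc hz0]
    · obtain ⟨z, hz, hlt, hmin⟩ := exists_contact Ω hΩo hcpt _ hun hbdn 0 x₀ (by simp)
        ⟨x, hx, by simpa using h⟩
      have hps := (contact Ω hΩo _ _ hGn hDn 0 z hz hmin).2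
      have := (linalg_bound hn _ (hsym2 z hz) hps (b z) θ hθ (hb z)).1
      rw [heq2 z hz] at this
      have hz0 : 0 < u z := by simpa using hlt
      by_contra hc
      push Not at hc
      nlinarith [mul_neg_of_neg_of_pos hc hz0]
  set m := sInf ((fun x => ‖G x‖) '' frontier Ω) with hm
  have hm0 : 0 ≤ m := Real.sInf_nonneg (by rintro _ ⟨x, _, rfl⟩; exact norm_nonneg _)
  have hmle : ∀ x ∈ frontier Ω, m ≤ ‖G x‖ := fun x hx =>
    csInf_le ⟨0, by rintro _ ⟨x, _, rfl⟩; exact norm_nonneg _⟩ ⟨x, hx, rfl⟩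
  -- covering
  have hcover : ball (0 : EuclideanSpace ℝ (Fin n)) m ⊆
      G '' {z | z ∈ Ω ∧ ∀ v, 0 ≤ ⟪fderiv ℝ G z v, v⟫} ∪
      (fun x => - G x) '' {z | z ∈ Ω ∧ ∀ v, 0 ≤ ⟪fderiv ℝ (fun x => - G x) z v, v⟫} := by
    intro p hp
    rw [mem_ball_zero_iff] at hp
    obtain ⟨x₀, hx₀, hmax⟩ := hfc.exists_isMaxOn hfne
      (f := fun x => ⟪p, x⟫) (Continuous.continuousOn (by fun_prop))
    have hmax' : ∀ x ∈ frontier Ω, ⟪p, x⟫ ≤ ⟪p, x₀⟫ := fun x hx => hmax hx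
    by_cases h1 : ∃ x ∈ Ω, u x - ⟪p, x⟫ < - ⟪p, x₀⟫
    · obtain ⟨z, hz, -, hmin⟩ := exists_contact Ω hΩo hcpt u hu hbd p x₀ hmax' h1
      obtain ⟨h2, h3⟩ := contact Ω hΩo u G hG (fun x hx => (hH x hx).1) p z hz hmin
      exact Or.inl ⟨z, ⟨hz, h3⟩, h2⟩
    by_cases h1' : ∃ x ∈ Ω, - u x - ⟪p, x⟫ < - ⟪p, x₀⟫
    · obtain ⟨z, hz, -, hmin⟩ := exists_contact Ω hΩo hcpt _ hun hbdn p x₀ hmax' h1'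
      obtain ⟨h2, h3⟩ := contact Ω hΩo _ _ hGn hDn p z hz hmin
      exact Or.inr ⟨z, ⟨hz, h3⟩, h2⟩
    exfalso
    push Not at h1 h1'
    refine boundary_contra Ω hΩo u G hu hGc hG hbd x₀ hx₀ ‖p‖ (norm_nonneg _)
      (hp.trans_le (hmle x₀ hx₀)) ?_
    intro x hx
    have e1 := h1 x hx
    have e2 := h1' x hx
    have e3 : -⟪p, x - x₀⟫ ≤ ‖p‖ * ‖x - x₀‖ := (neg_le_abs _).trans (abs_real_inner_le_norm _ _)
    rw [inner_sub_right] at e3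
    rw [abs_le]
    constructor <;> linarith
  have hA := half_bound hn Ω hΩo u (hu.mono subset_closure) G (fun x hx => (hH x hx).1)
    (fun x hx => (hH x hx).2.1) b θ hθ hb lam heq1
  have hB := half_bound hn Ω hΩo _ (hun.mono subset_closure) _ hDn hsym2 b θ hθ hb lam heq2
  have hint : IntegrableOn (fun x => |u x| ^ n) Ω :=
    ((hu.abs.pow n).integrableOn_compact hcpt).mono_set subset_closure
  have hsum : volume (ball (0 : EuclideanSpace ℝ (Fin n)) m) ≤
      ENNReal.ofReal ((lam / (n * θ)) ^ n * ∫ x in Ω, |u x| ^ n) := by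
    refine (measure_mono hcover).trans ((measure_union_le _ _).trans ((add_le_add hA hB).trans ?_))
    rw [← lintegral_add_left', ← integral_const_mul, ofReal_integral_eq_lintegral_ofReal]
    · refine lintegral_mono fun x => ?_
      rw [← ENNReal.ofReal_add (by positivity) (by positivity)]
      apply ENNReal.ofReal_le_ofReal
      rw [← mul_pow]
      rcases le_total 0 (u x) with h | h
      · have : 0 ≤ lam * u x := mul_nonneg hlam h
        rw [max_eq_right (by linarith), max_eq_left (by linarith), abs_of_nonneg h]
        simp only [zero_div, zero_pow hn.ne', zero_add]
        apply le_of_eq; ring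
      · have : lam * u x ≤ 0 := mul_nonpos_of_nonneg_of_nonpos hlam h
        rw [max_eq_left (by linarith), max_eq_right (by linarith), abs_of_nonpos h]
        simp only [zero_div, zero_pow hn.ne', add_zero]
        apply le_of_eq; ring
    · exact hint.const_mul _
    · exact Eventually.of_forall fun x => by positivity
    · have : AEMeasurable u (volume.restrict Ω) :=
        (hu.mono subset_closure).aemeasurable hΩo.measurableSet
      exact ((((this.const_mul lam).neg.max aemeasurable_const).div_const _).pow_const n).ennreal_ofReal
  have hI : 0 ≤ ∫ x in Ω, |u x| ^ n := integral_nonneg fun x => by positivity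
  have hreal : m ^ n * (volume (ball (0 : EuclideanSpace ℝ (Fin n)) 1)).toReal ≤
      (lam / (n * θ)) ^ n * ∫ x in Ω, |u x| ^ n := by
    have : Nonempty (Fin n) := ⟨⟨0, hn⟩⟩
    have hvol := Measure.addHaar_ball (volume : Measure (EuclideanSpace ℝ (Fin n))) 0 hm0
    rw [hvol] at hsum
    have := ENNReal.toReal_mono ENNReal.ofReal_ne_top hsum
    rw [ENNReal.toReal_mul, ENNReal.toReal_ofReal (by positivity),
      ENNReal.toReal_ofReal (by positivity)] at this
    simpa using this
  simp only [Real.rpow_natCast]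
  exact final_arith n hn θ m _ lam _ hθ hm0 ENNReal.toReal_nonneg hlam hI hreal
end
end
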